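/- arXiv:1610.09475 — 2 statements merged into one kernel-verified Lean document; each statement's English description precedes it below -/
import Mathlib

section
/- Let n ≥ 3, ε ∈ {−1,1}^n, u, v ∈ ℂ, and let P ∈ ℂ[X_1,…,X_n] be a nonzero (ε,u,v)-covariant symbol. Then ℓ := v − u belongs to ℕ and there exists c ∈ ℂ, c ≠ 0, such that P = c · P^{ε,μ}_ℓ, where μ = u − (n−1)/2. (Scalar case of the classification of conformal symmetry breaking operators: up to scalar, every scalar-valued conformally covariant differential operator from ℝ^{p,q} to a nondegenerate hyperplane is a Juhl operator.) -/
open scoped BigOperators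

noncomputable section

def pd {n : ℕ} {E : Type} [NormedAddCommGroup E] [NormedSpace ℝ E]
    (j : Fin n) (f : (Fin n → ℝ) → E) : (Fin n → ℝ) → E :=
  fun x => fderiv ℝ f x (Pi.single j 1)

def akCoeff (μ : ℂ) (ℓ k : ℕ) : ℂ :=
  ((-1 : ℂ) ^ k * 2 ^ (ℓ - 2 * k) / (Nat.factorial k * Nat.factorial (ℓ - 2 * k))) *
    ∏ j ∈ Finset.Ico ((ℓ + 1) / 2) (ℓ - k), (μ + (j : ℂ))

def sLap {n : ℕ} (ε : Fin n → ℝ) (i₀ : Fin n) (f : (Fin n → ℝ) → ℂ) : (Fin n → ℝ) → ℂ :=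
  fun x => (-(ε i₀ : ℂ)) * ∑ j ∈ Finset.univ.erase i₀, (ε j : ℂ) * pd j (pd j f) x

def juhlOp {n : ℕ} (ε : Fin n → ℝ) (i₀ : Fin n) (μ : ℂ) (ℓ : ℕ)
    (f : (Fin n → ℝ) → ℂ) : (Fin n → ℝ) → ℂ :=
  fun x => ∑ k ∈ Finset.range (ℓ / 2 + 1),
    akCoeff μ ℓ k * ((sLap ε i₀)^[k] ((pd i₀)^[ℓ - 2 * k] f)) x

def juhlSymbol {n : ℕ} (ε : Fin n → ℝ) (i₀ : Fin n) (μ : ℂ) (ℓ : ℕ) :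
    MvPolynomial (Fin n) ℂ :=
  ∑ k ∈ Finset.range (ℓ / 2 + 1),
    MvPolynomial.C (akCoeff μ ℓ k) *
      (MvPolynomial.C (-(ε i₀ : ℂ)) *
        ∑ j ∈ Finset.univ.erase i₀, MvPolynomial.C ((ε j : ℂ)) * MvPolynomial.X j ^ 2) ^ k *
      MvPolynomial.X i₀ ^ (ℓ - 2 * k)

def monoDiff {n : ℕ} (m : Fin n → ℕ) (f : (Fin n → ℝ) → ℂ) : (Fin n → ℝ) → ℂ :=
  (List.finRange n).foldr (fun j g => (pd j)^[m j] g) f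

def polyDiff {n : ℕ} (P : MvPolynomial (Fin n) ℂ) (f : (Fin n → ℝ) → ℂ) :
    (Fin n → ℝ) → ℂ :=
  fun x => ∑ m ∈ P.support, P.coeff m * monoDiff (fun j => m j) f x

def IsConformalKillingPair {n : ℕ} (ε : Fin n → ℝ) (V : Set (Fin n → ℝ))
    (Z : (Fin n → ℝ) → (Fin n → ℝ)) (ρ : (Fin n → ℝ) → ℝ) : Prop :=
  ContDiffOn ℝ (⊤ : ℕ∞) Z V ∧ ContDiffOn ℝ (⊤ : ℕ∞) ρ V ∧
    ∀ i j : Fin n, ∀ x ∈ V,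
      ε i * pd j (fun y => Z y i) x + ε j * pd i (fun y => Z y j) x
        = ρ x * ε i * (if i = j then 1 else 0)

def IsCovariantSymbol {n : ℕ} (ε : Fin n → ℝ) (i₀ : Fin n) (u v : ℂ)
    (P : MvPolynomial (Fin n) ℂ) : Prop :=
  ∀ (Z : (Fin n → ℝ) → (Fin n → ℝ)) (ρ : (Fin n → ℝ) → ℝ),
    IsConformalKillingPair ε Set.univ Z ρ →
    (∀ x : Fin n → ℝ, x i₀ = 0 → Z x i₀ = 0) →
    ∀ f : (Fin n → ℝ) → ℂ, ContDiff ℝ (⊤ : ℕ∞) f →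
    ∀ x : Fin n → ℝ, x i₀ = 0 →
      polyDiff P (fun y => (∑ j, (Z y j : ℂ) * pd j f y) + u / 2 * (ρ y : ℂ) * f y) x
        = (∑ j ∈ Finset.univ.erase i₀, (Z x j : ℂ) * pd j (polyDiff P f) x)
          + v / 2 * (ρ x : ℂ) * polyDiff P f x

set_option linter.all false
open MvPolynomial in
def evp {n : ℕ} {A : Type} [NormedField A] [NormedAlgebra ℝ A]
    (F : MvPolynomial (Fin n) A) : (Fin n → ℝ) → A :=
  fun x => eval (fun i => algebraMap ℝ A (x i)) F

section part1
open MvPolynomial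
variable {n : ℕ} {A : Type} [NormedField A] [NormedAlgebra ℝ A]

theorem evp_C_fun (a : A) : evp (C a : MvPolynomial (Fin n) A) = fun _ => a := by
  funext x; simp [evp]

theorem evp_add_fun (p q : MvPolynomial (Fin n) A) :
    evp (p + q) = fun x => evp p x + evp q x := by
  funext x; simp [evp]

theorem evp_mul_X_fun (p : MvPolynomial (Fin n) A) (i : Fin n) :
    evp (p * X i) = fun x => evp p x * algebraMap ℝ A (x i) := by
  funext x; simp [evp]

theorem evp_contDiff (F : MvPolynomial (Fin n) A) : ContDiff ℝ (⊤ : ℕ∞) (evp F) := by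
  induction F using MvPolynomial.induction_on with
  | C a => rw [evp_C_fun]; exact contDiff_const
  | add p q hp hq => rw [evp_add_fun]; exact hp.add hq
  | mul_X p i hp =>
    have h : ContDiff ℝ (⊤ : ℕ∞) (fun x : Fin n → ℝ => algebraMap ℝ A (x i)) :=
      (algebraMapCLM ℝ A).contDiff.comp (contDiff_apply ℝ ℝ i)
    rw [evp_mul_X_fun]; exact hp.mul h

theorem evp_hasFDerivAt (F : MvPolynomial (Fin n) A) (x : Fin n → ℝ) :
    ∃ L : (Fin n → ℝ) →L[ℝ] A, HasFDerivAt (evp F) L x ∧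
      ∀ j, L (Pi.single j 1) = evp (pderiv j F) x := by
  induction F using MvPolynomial.induction_on with
  | C a =>
    refine ⟨0, ?_, by simp [evp]⟩
    rw [evp_C_fun]; exact hasFDerivAt_const a x
  | add p q hp hq =>
    obtain ⟨L, hL, h1⟩ := hp
    obtain ⟨M, hM, h2⟩ := hq
    refine ⟨L + M, ?_, fun j => ?_⟩
    · rw [evp_add_fun]; exact hL.add hM
    · rw [map_add, evp_add_fun]; simp [h1, h2]
  | mul_X p i hp =>
    obtain ⟨L, hL, h1⟩ := hp
    have h : HasFDerivAt (fun x : Fin n → ℝ => algebraMap ℝ A (x i))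
        ((algebraMapCLM ℝ A).comp (ContinuousLinearMap.proj (R := ℝ) (φ := fun _ : Fin n => ℝ) i)) x :=
      ((algebraMapCLM ℝ A).comp (ContinuousLinearMap.proj (R := ℝ) (φ := fun _ : Fin n => ℝ) i)).hasFDerivAt
    rw [evp_mul_X_fun]
    refine ⟨_, hL.mul h, ?_⟩
    intro j
    simp only [ContinuousLinearMap.add_apply, ContinuousLinearMap.smul_apply, h1]
    by_cases hij : i = j
    · subst hij; simp [evp, pderiv_mul]
    · simp [evp, pderiv_mul, hij]

theorem pd_evp (F : MvPolynomial (Fin n) A) (j : Fin n) : pd j (evp F) = evp (pderiv j F) := by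
  ext x
  obtain ⟨L, hL, h1⟩ := evp_hasFDerivAt F x
  simp [pd, hL.fderiv, h1]

theorem pd_iter_evp (F : MvPolynomial (Fin n) A) (j : Fin n) (k : ℕ) :
    (pd j)^[k] (evp F) = evp ((pderiv j)^[k] F) := by
  induction k generalizing F with
  | zero => rfl
  | succ k ih => rw [Function.iterate_succ_apply, pd_evp, ih, Function.iterate_succ_apply]

theorem evp_zero (F : MvPolynomial (Fin n) A) : evp F 0 = coeff 0 F := by
  simp [evp]
  rfl

theorem coeff_iter (F : MvPolynomial (Fin n) A) (j : Fin n) (k : ℕ) (m : Fin n →₀ ℕ) :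
    coeff m ((pderiv j)^[k] F) = coeff (m + Finsupp.single j k) F * ((m j + 1).ascFactorial k : ℕ) := by
  induction k generalizing F with
  | zero => simp
  | succ k ih =>
    rw [Function.iterate_succ_apply, ih, coeff_pderiv, add_assoc, ← Finsupp.single_add,
      Nat.ascFactorial_succ]
    simp
    ring

theorem coeff_foldr (F : MvPolynomial (Fin n) A) (m : Fin n → ℕ) (l : List (Fin n)) (hl : l.Nodup)
    (m' : Fin n →₀ ℕ) (hm : ∀ j ∈ l, m' j = 0) :
    coeff m' (l.foldr (fun j g => (pderiv j)^[m j] g) F) =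
      coeff (m' + (l.map (fun j => Finsupp.single j (m j))).sum) F *
        ((l.map (fun j => (m j).factorial)).prod : ℕ) := by
  induction l generalizing m' with
  | nil => simp
  | cons a l ih =>
    rw [List.nodup_cons] at hl
    rw [List.foldr_cons, coeff_iter, ih hl.2]
    · simp only [List.map_cons, List.sum_cons, List.prod_cons, add_assoc, hm a (by simp)]
      rw [zero_add, Nat.one_ascFactorial]
      push_cast; ring
    · intro j hj
      have : j ≠ a := by rintro rfl; exact hl.1 hj
      simp [hm j (by simp [hj]), this]

theorem foldr_evp (F : MvPolynomial (Fin n) ℂ) (m : Fin n → ℕ) :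
    monoDiff m (evp F) = evp ((List.finRange n).foldr (fun j g => (pderiv j)^[m j] g) F) := by
  unfold monoDiff
  induction (List.finRange n) with
  | nil => rfl
  | cons a l ih => rw [List.foldr_cons, ih, pd_iter_evp]; rfl

theorem monoDiff_evp (F : MvPolynomial (Fin n) ℂ) (m : Fin n →₀ ℕ) :
    monoDiff (fun j => m j) (evp F) 0 = coeff m F * ((∏ j, (m j).factorial : ℕ) : ℂ) := by
  rw [foldr_evp, evp_zero, coeff_foldr _ _ _ (List.nodup_finRange n) _ (by simp)]
  congr 2
  · rw [zero_add]
    conv_rhs => rw [← Finsupp.univ_sum_single m]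
    rw [← List.ofFn_eq_map, List.sum_ofFn]

/-- the pairing -/
def pairing (P F : MvPolynomial (Fin n) ℂ) : ℂ :=
  ∑ m ∈ P.support, P.coeff m * (coeff m F * ((∏ j, (m j).factorial : ℕ) : ℂ))

theorem polyDiff_evp (P F : MvPolynomial (Fin n) ℂ) : polyDiff P (evp F) 0 = pairing P F := by
  simp [polyDiff, pairing, monoDiff_evp]

theorem pairing_add (P F G : MvPolynomial (Fin n) ℂ) :
    pairing P (F + G) = pairing P F + pairing P G := by
  simp [pairing, add_mul, mul_add, Finset.sum_add_distrib]

theorem pairing_smul (P F : MvPolynomial (Fin n) ℂ) (c : ℂ) :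
    pairing P (C c * F) = c * pairing P F := by
  simp only [pairing, coeff_C_mul, Finset.mul_sum]
  exact Finset.sum_congr rfl fun _ _ => by ring

theorem pairing_monomial (P : MvPolynomial (Fin n) ℂ) (m : Fin n →₀ ℕ) (b : ℂ) :
    pairing P (monomial m b) = b * (P.coeff m * ((∏ j, (m j).factorial : ℕ) : ℂ)) := by
  unfold pairing
  rw [Finset.sum_eq_single m]
  · simp; ring
  · intro m' _ h; simp [coeff_monomial, Ne.symm h]
  · intro h; rw [notMem_support_iff] at h; simp [h]

theorem pairing_sum {ι : Type} (s : Finset ι) (P : MvPolynomial (Fin n) ℂ)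
    (F : ι → MvPolynomial (Fin n) ℂ) : pairing P (∑ i ∈ s, F i) = ∑ i ∈ s, pairing P (F i) := by
  classical
  induction s using Finset.induction_on with
  | empty => simp [pairing]
  | insert a s ha ih => rw [Finset.sum_insert ha, Finset.sum_insert ha, pairing_add, ih]

theorem fact_add (m : Fin n →₀ ℕ) (j : Fin n) :
    ∏ i, ((m + Finsupp.single j 1 : Fin n →₀ ℕ) i).factorial = (m j + 1) * ∏ i, (m i).factorial := by
  rw [← Finset.mul_prod_erase _ _ (Finset.mem_univ j),
    ← Finset.mul_prod_erase (a := j) (f := fun i => (m i).factorial) _ (Finset.mem_univ j)]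
  rw [← mul_assoc]
  congr 1
  · simp [Nat.factorial_succ]
  · refine Finset.prod_congr rfl fun i hi => ?_
    rw [Finsupp.add_apply, Finsupp.single_eq_of_ne (Finset.ne_of_mem_erase hi), add_zero]

theorem pairing_X (P F : MvPolynomial (Fin n) ℂ) (j : Fin n) :
    pairing P (X j * F) = pairing (pderiv j P) F := by
  induction F using MvPolynomial.induction_on' with
  | add p q hp hq => rw [mul_add, pairing_add, pairing_add, hp, hq]
  | monomial m a =>
    rw [X, monomial_mul, pairing_monomial, pairing_monomial, coeff_pderiv, add_comm, fact_add]
    push_cast; ring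

theorem pairing_pderiv (P F : MvPolynomial (Fin n) ℂ) (j : Fin n) :
    pairing P (pderiv j F) = pairing (X j * P) F := by
  induction F using MvPolynomial.induction_on' with
  | add p q hp hq => rw [map_add, pairing_add, pairing_add, hp, hq]
  | monomial m a =>
    rw [pderiv_monomial, pairing_monomial, pairing_monomial, coeff_X_mul']
    by_cases h : m j = 0
    · simp [h]
    · obtain ⟨m', rfl⟩ : ∃ m', m = m' + Finsupp.single j 1 :=
        ⟨m - Finsupp.single j 1, (Finsupp.sub_add_single_one_cancel h).symm⟩
      rw [fact_add]
      simp
      ring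

theorem pairing_ext (P Q : MvPolynomial (Fin n) ℂ) (h : ∀ F, pairing P F = pairing Q F) : P = Q := by
  ext m
  have := h (monomial m 1)
  rw [pairing_monomial, pairing_monomial, one_mul, one_mul] at this
  refine mul_right_cancel₀ ?_ this
  exact_mod_cast Finset.prod_ne_zero_iff.mpr fun i _ => Nat.factorial_ne_zero _

theorem cov_pairing (ε : Fin n → ℝ) (i₀ : Fin n) (u v : ℂ) (P : MvPolynomial (Fin n) ℂ)
    (hcov : IsCovariantSymbol ε i₀ u v P) (z : Fin n → MvPolynomial (Fin n) ℝ)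
    (r : MvPolynomial (Fin n) ℝ)
    (hk : ∀ i j, C (ε i) * pderiv j (z i) + C (ε j) * pderiv i (z j) =
      if i = j then r * C (ε i) else 0)
    (hz : ∀ x : Fin n → ℝ, x i₀ = 0 → evp (z i₀) x = 0)
    (hz0 : ∀ i, coeff 0 (z i) = 0) (F : MvPolynomial (Fin n) ℂ) :
    pairing P (∑ j, map (algebraMap ℝ ℂ) (z j) * pderiv j F
      + C (u / 2) * (map (algebraMap ℝ ℂ) r * F)) = v / 2 * (coeff 0 r : ℝ) * pairing P F := by
  have hmap : ∀ (q : MvPolynomial (Fin n) ℝ) (y : Fin n → ℝ),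
      evp (map (algebraMap ℝ ℂ) q) y = ((evp q y : ℝ) : ℂ) := by
    intro q y
    simp only [evp, eval_map]
    have := (MvPolynomial.eval₂_comp_left (algebraMap ℝ ℂ) (RingHom.id ℝ) y q).symm
    simp at this
    exact this
  have key := hcov (fun y i => evp (z i) y) (evp r) ⟨?_, ?_, ?_⟩ hz (evp F) (evp_contDiff F) 0 rfl
  · simp only [evp_zero, hz0, polyDiff_evp] at key
    rw [← polyDiff_evp]
    simp only [Complex.ofReal_zero, zero_mul, Finset.sum_const_zero, zero_add] at key
    rw [← key]
    congr 1
    funext y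
    simp only [pd_evp, ← hmap]
    simp [evp]
    ring
  · exact (contDiff_pi.mpr fun i => evp_contDiff (z i)).contDiffOn
  · exact (evp_contDiff r).contDiffOn
  · intro i j x _
    have h := congrArg (fun q => evp q x) (hk i j)
    have e : ∀ k, (fun y => evp (z k) y) = evp (z k) := fun _ => rfl
    rw [e, e, pd_evp, pd_evp]
    by_cases hij : i = j
    · simpa [evp, hij] using h
    · simpa [evp, hij] using h
end part1
section part2
open MvPolynomial
variable {n : ℕ}

theorem pairing_comm (P F : MvPolynomial (Fin n) ℂ) : pairing P F = pairing F P := by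
  classical
  have h : ∀ (P F : MvPolynomial (Fin n) ℂ) (s : Finset (Fin n →₀ ℕ)), P.support ⊆ s →
      pairing P F = ∑ m ∈ s, P.coeff m * (coeff m F * ((∏ j, (m j).factorial : ℕ) : ℂ)) := by
    intro P F s hs
    refine Finset.sum_subset hs fun m _ hm => ?_
    rw [notMem_support_iff] at hm; simp [hm]
  rw [h P F (P.support ∪ F.support) Finset.subset_union_left,
    h F P (P.support ∪ F.support) Finset.subset_union_right]
  exact Finset.sum_congr rfl fun _ _ => by ring

theorem pairing_add_left (P Q F : MvPolynomial (Fin n) ℂ) :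
    pairing (P + Q) F = pairing P F + pairing Q F := by
  rw [pairing_comm, pairing_add, pairing_comm F, pairing_comm F]

theorem pairing_smul_left (P F : MvPolynomial (Fin n) ℂ) (c : ℂ) :
    pairing (C c * P) F = c * pairing P F := by
  rw [pairing_comm, pairing_smul, pairing_comm F]

theorem pairing_sum_left {ι : Type} (s : Finset ι) (F : MvPolynomial (Fin n) ℂ)
    (P : ι → MvPolynomial (Fin n) ℂ) : pairing (∑ i ∈ s, P i) F = ∑ i ∈ s, pairing (P i) F := by
  rw [pairing_comm, pairing_sum]; simp only [pairing_comm F]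

theorem cov_dil (ε : Fin n → ℝ) (i₀ : Fin n) (u v : ℂ) (P : MvPolynomial (Fin n) ℂ)
    (hcov : IsCovariantSymbol ε i₀ u v P) (m : Fin n →₀ ℕ) (hm : P.coeff m ≠ 0) :
    v - u = (m.degree : ℂ) := by
  have h := cov_pairing ε i₀ u v P hcov (fun i => X i) (C 2) ?_ ?_ ?_ (monomial m 1)
  · have e : ∑ j, map (algebraMap ℝ ℂ) (X j) * pderiv j (monomial m (1:ℂ))
        = C (m.degree : ℂ) * monomial m 1 := by
      simp only [map_X, X_mul_pderiv_monomial]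
      rw [← Finset.sum_smul, Finsupp.degree_eq_sum]
      rw [C_mul_monomial, smul_monomial]
      simp
    have e2 : map (algebraMap ℝ ℂ) (C 2 : MvPolynomial (Fin n) ℝ) = C 2 := by simp
    rw [e, e2, pairing_add, pairing_smul, pairing_smul, pairing_smul] at h
    have h0 : pairing P (monomial m 1) ≠ 0 := by
      rw [pairing_monomial, one_mul]
      refine mul_ne_zero hm ?_
      exact_mod_cast Finset.prod_ne_zero_iff.mpr fun i _ => Nat.factorial_ne_zero _
    have h1 : ((m.degree : ℂ) + u) * pairing P (monomial m 1) = v * pairing P (monomial m 1) := by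
      simp at h
      linear_combination h
    linear_combination -(mul_right_cancel₀ h0 h1)
  · intro i j
    by_cases hij : i = j
    · subst hij
      have h2 : (C 2 : MvPolynomial (Fin n) ℝ) = 2 := rfl
      simp [h2]; ring
    · simp [hij, Ne.symm hij]
  · intro x hx; simpa [evp] using hx
  · intro i; simp

theorem cov_rot (ε : Fin n → ℝ) (i₀ : Fin n) (u v : ℂ) (P : MvPolynomial (Fin n) ℂ)
    (hcov : IsCovariantSymbol ε i₀ u v P) (a b : Fin n) (ha : a ≠ i₀) (hb : b ≠ i₀) (hab : a ≠ b) :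
    C (ε b : ℂ) * (X a * pderiv b P) = C (ε a : ℂ) * (X b * pderiv a P) := by
  refine pairing_ext _ _ fun F => ?_
  have h := cov_pairing ε i₀ u v P hcov
    (fun i => if i = a then C (ε b) * X b else if i = b then C (-ε a) * X a else 0) 0 ?_ ?_ ?_ F
  · rw [← Finset.add_sum_erase _ _ (Finset.mem_univ a),
      ← Finset.add_sum_erase (a := b) _ _ (by simp [hab.symm])] at h
    rw [Finset.sum_eq_zero (s := (Finset.univ.erase a).erase b)] at h
    · simp only [hab.symm, if_true, if_false, map_mul, map_C, map_X, map_zero, zero_mul, mul_zero,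
        add_zero, pairing_add, mul_assoc, pairing_smul, pairing_X, pairing_pderiv] at h
      rw [pairing_smul_left, pairing_smul_left]
      simp at h
      linear_combination h
    · intro j hj
      simp at hj
      simp [hj]
  · intro i j
    by_cases hij : i = j
    · subst hij
      by_cases h1 : i = a
      · subst h1; simp [hab.symm]
      · by_cases h2 : i = b
        · subst h2; simp [hab, hab.symm]
        · simp [h1, h2]
    · rw [if_neg hij]
      by_cases h1 : i = a
      · subst h1
        by_cases h2 : j = b
        · subst h2; simp [hab.symm]; ring
        · simp [Ne.symm hij, h2, Ne.symm h2]
      · by_cases h1' : i = b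
        · subst h1'
          by_cases h2 : j = a
          · subst h2; simp [hab.symm]; ring
          · simp [Ne.symm hij, h2, hab.symm, Ne.symm h2]
        · by_cases h2 : j = a
          · subst h2; simp [h1, h1', Ne.symm h1']
          · by_cases h3 : j = b
            · subst h3; simp [h1, h1', Ne.symm h1, hab.symm]
            · simp [h1, h1', h2, h3]
  · intro x hx; simp [ha.symm, hb.symm, evp]
  · intro i
    split_ifs <;> simp

theorem cov_spec (ε : Fin n → ℝ) (hε : ∀ j, ε j = 1 ∨ ε j = -1)
    (i₀ : Fin n) (u v : ℂ) (P : MvPolynomial (Fin n) ℂ)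
    (hcov : IsCovariantSymbol ε i₀ u v P) (a : Fin n) (ha : a ≠ i₀) :
    C (2 * ε a : ℂ) * (∑ j, X j * pderiv j (pderiv a P)) + C (2 * u * ε a) * pderiv a P =
      X a * ∑ k, C (ε k : ℂ) * pderiv k (pderiv k P) := by
  have aux : C (2 * ε a : ℂ) * (∑ j, X j * pderiv j (pderiv a P)) + C (2 * u * ε a) * pderiv a P
      + ∑ k, C (- ε k : ℂ) * (X a * pderiv k (pderiv k P)) = 0 := by
    refine pairing_ext _ _ fun F => ?_
    have h := cov_pairing ε i₀ u v P hcov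
      (fun i => C (2 * ε a) * (X a * X i) + if i = a then ∑ k, C (- ε k) * (X k * X k) else 0)
        (C (4 * ε a) * X a) ?_ ?_ ?_ F
    · have h0 : pairing (0 : MvPolynomial (Fin n) ℂ) F = 0 := by simp [pairing]
      rw [h0]
      simp only [map_add, map_mul, map_C, map_X, add_mul, Finset.sum_add_distrib, apply_ite (map (algebraMap ℝ ℂ)),
        map_zero, ite_mul, zero_mul, Finset.sum_ite_eq', Finset.mem_univ, if_true, map_sum,
        Finset.sum_mul, pairing_add] at h
      simp only [pairing_sum, mul_assoc] at h
      simp only [← map_mul, pairing_smul, pairing_X, pairing_pderiv] at h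
      simp only [pairing_add_left, pairing_smul_left, pairing_sum_left]
      simp [← Finset.mul_sum, pairing_smul, pairing_X] at h ⊢
      linear_combination h
    · intro i j
      have h2 : (C 2 : MvPolynomial (Fin n) ℝ) = 2 := rfl
      have h4 : (C 4 : MvPolynomial (Fin n) ℝ) = 4 := rfl
      have hd : ∀ j, pderiv j (2 : MvPolynomial (Fin n) ℝ) = 0 := by
        intro j; rw [← h2, pderiv_C]
      have hp : ∀ j, pderiv j (∑ k, C (- ε k) * (X k * X k) : MvPolynomial (Fin n) ℝ)
          = C (- 2 * ε j) * X j := by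
        intro j
        rw [map_sum, Finset.sum_eq_single j]
        · simp [h2]; ring
        · intro k _ hk; simp [hk]
        · simp
      have hc : (C (ε a) * C (ε a) : MvPolynomial (Fin n) ℝ) = 1 := by
        rw [← C_mul]; rcases hε a with h | h <;> simp [h]
      by_cases hij : i = j
      · subst hij
        by_cases h1 : i = a
        · subst h1
          simp only [map_add, if_true, hp]
          simp [h2, h4, hd]; ring
        · simp [h1, Ne.symm h1, h2, h4, hd]; ring
      · rw [if_neg hij]
        by_cases h1 : i = a
        · subst h1
          have h3 := Ne.symm hij
          simp only [map_add, if_true, hp, if_neg h3]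
          simp [h2, h4, hd, hij, h3]; ring
        · by_cases h3 : j = a
          · subst h3
            simp only [map_add, if_true, hp, if_neg h1]
            simp [h2, h4, hd, hij, h1, Ne.symm h1]; ring
          · simp [h1, h3, hij, Ne.symm hij, Ne.symm h1, Ne.symm h3]
    · intro x hx; simp [ha.symm, evp, hx]
    · intro i
      rw [← constantCoeff_eq]
      split_ifs <;> simp
  rw [← sub_eq_zero, ← aux, sub_eq_add_neg, Finset.mul_sum (a := X a), ← Finset.sum_neg_distrib]
  congr 1
  refine Finset.sum_congr rfl fun k _ => ?_
  simp only [map_neg]; ring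
end part2
open MvPolynomial in
def Qp {n : ℕ} (e : Fin n → ℂ) (i₀ : Fin n) : MvPolynomial (Fin n) ℂ :=
  ∑ j ∈ Finset.univ.erase i₀, C (e j) * X j ^ 2

section part3
open MvPolynomial
variable {n : ℕ}

theorem pderiv_Qp (e : Fin n → ℂ) (i₀ a : Fin n) (ha : a ≠ i₀) :
    pderiv a (Qp e i₀) = 2 * (C (e a) * X a) := by
  unfold Qp
  rw [map_sum, Finset.sum_eq_single a]
  · rw [pderiv_C_mul, pderiv_pow]; simp; ring
  · intro k _ hk; rw [pderiv_C_mul, pderiv_pow]; simp [hk]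
  · simp [ha]

theorem pderiv_Qp_self (e : Fin n → ℂ) (i₀ : Fin n) :
    pderiv i₀ (Qp e i₀) = 0 := by
  unfold Qp
  rw [map_sum, Finset.sum_eq_zero]
  intro k hk; rw [pderiv_C_mul, pderiv_pow]; simp [Finset.ne_of_mem_erase hk]

theorem Qp_hom (e : Fin n → ℂ) (i₀ : Fin n) : (Qp e i₀).IsHomogeneous 2 := by
  unfold Qp
  exact IsHomogeneous.sum _ _ _ fun j _ => isHomogeneous_C_mul_X_pow _ _ _

theorem pderiv_comm' (P : MvPolynomial (Fin n) ℂ) (a b : Fin n) :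
    pderiv a (pderiv b P) = pderiv b (pderiv a P) := by
  by_cases hab : a = b
  · rw [hab]
  ext m
  simp only [coeff_pderiv]
  rw [add_right_comm]
  simp [hab, Ne.symm hab]
  ring

theorem eq_pow_of_pderiv_zero (i₀ : Fin n) (l : ℕ) (P : MvPolynomial (Fin n) ℂ)
    (hP : P.IsHomogeneous l) (h : ∀ a, a ≠ i₀ → pderiv a P = 0) :
    ∃ b : ℂ, P = C b * X i₀ ^ l := by
  refine ⟨coeff (Finsupp.single i₀ l) P, ?_⟩
  ext m
  rw [coeff_C_mul, coeff_X_pow]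
  by_cases hm : Finsupp.single i₀ l = m
  · simp [hm]
  rw [if_neg hm, mul_zero]
  by_cases h1 : ∃ a, a ≠ i₀ ∧ m a ≠ 0
  · obtain ⟨a, ha, hma⟩ := h1
    obtain ⟨m', rfl⟩ : ∃ m', m = m' + Finsupp.single a 1 :=
      ⟨m - Finsupp.single a 1, (Finsupp.sub_add_single_one_cancel hma).symm⟩
    have := congrArg (coeff m') (h a ha)
    rw [coeff_pderiv, coeff_zero] at this
    exact (mul_eq_zero.mp this).resolve_right (Nat.cast_add_one_ne_zero _)
  · push Not at h1
    apply hP.coeff_eq_zero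
    intro hd
    apply hm
    have e : m = Finsupp.single i₀ (m i₀) := by
      ext a
      by_cases ha : a = i₀
      · simp [ha]
      · rw [h1 a ha, Finsupp.single_eq_of_ne ha]
    rw [e, Finsupp.degree_single] at hd
    rw [e, hd]

theorem pderiv_term (e : Fin n → ℂ) (i₀ a : Fin n) (ha : a ≠ i₀) (k m : ℕ) :
    pderiv a (Qp e i₀ ^ (k + 1) * X i₀ ^ m) =
      C (2 * (k + 1) : ℂ) * (C (e a) * X a * (Qp e i₀ ^ k * X i₀ ^ m)) := by
  have h2 : (C 2 : MvPolynomial (Fin n) ℂ) = 2 := rfl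
  rw [pderiv_mul, pderiv_pow, pderiv_pow, pderiv_Qp e i₀ a ha]
  simp [ha.symm, h2]
  ring

theorem rot_dvd (e : Fin n → ℂ) (he : ∀ j, e j * e j = 1) (i₀ : Fin n)
    (a₀ b₀ : Fin n) (ha₀ : a₀ ≠ i₀) (hb₀ : b₀ ≠ i₀) (hab₀ : a₀ ≠ b₀) (P : MvPolynomial (Fin n) ℂ)
    (h : ∀ a b, a ≠ i₀ → b ≠ i₀ → a ≠ b →
      C (e b) * (X a * pderiv b P) = C (e a) * (X b * pderiv a P)) :
    ∃ R, ∀ a, a ≠ i₀ → pderiv a P = C (e a) * X a * R := by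
  have hC : ∀ j, (C (e j) * C (e j) : MvPolynomial (Fin n) ℂ) = 1 := by
    intro j; rw [← C_mul, he, C_1]
  have h1 : ∀ a, a ≠ i₀ → ∃ R, pderiv a P = C (e a) * X a * R := by
    intro a ha
    obtain ⟨b, hb, hab⟩ : ∃ b, b ≠ i₀ ∧ a ≠ b := by
      by_cases haa : a = a₀
      · exact ⟨b₀, hb₀, haa ▸ hab₀⟩
      · exact ⟨a₀, ha₀, haa⟩
    have h2 : X a ∣ X b * pderiv a P := by
      refine ⟨C (e a) * C (e b) * pderiv b P, ?_⟩
      linear_combination (-(X b * pderiv a P)) * hC a - C (e a) * h a b ha hb hab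
    rw [X_dvd_mul_iff, X_dvd_X] at h2
    obtain ⟨S, hS⟩ := h2.resolve_left hab
    exact ⟨C (e a) * S, by rw [hS]; linear_combination (-(X a * S)) * hC a⟩
  obtain ⟨R, hR⟩ := h1 a₀ ha₀
  refine ⟨R, fun a ha => ?_⟩
  by_cases haa : a = a₀
  · rw [haa, hR]
  obtain ⟨S, hS⟩ := h1 a ha
  have h3 := h a a₀ ha ha₀ haa
  rw [hR, hS] at h3
  have h4 : (X a * X a₀ : MvPolynomial (Fin n) ℂ) * R = X a * X a₀ * S := by
    linear_combination h3 - (X a * X a₀ * R) * hC a₀ + X a * X a₀ * S * hC a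
  rw [hS, mul_left_cancel₀ (mul_ne_zero (X_ne_zero a) (X_ne_zero a₀)) h4]

theorem structure_lem (e : Fin n → ℂ) (he : ∀ j, e j * e j = 1) (i₀ : Fin n)
    (a₀ b₀ : Fin n) (ha₀ : a₀ ≠ i₀) (hb₀ : b₀ ≠ i₀) (hab₀ : a₀ ≠ b₀) (l : ℕ)
    (P : MvPolynomial (Fin n) ℂ) (hP : P.IsHomogeneous l)
    (h : ∀ a b, a ≠ i₀ → b ≠ i₀ → a ≠ b →
      C (e b) * (X a * pderiv b P) = C (e a) * (X b * pderiv a P)) :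
    ∃ b : ℕ → ℂ, P = ∑ k ∈ Finset.range (l / 2 + 1),
      C (b k) * (Qp e i₀ ^ k * X i₀ ^ (l - 2 * k)) := by
  have hC : ∀ j, (C (e j) * C (e j) : MvPolynomial (Fin n) ℂ) = 1 := by
    intro j; rw [← C_mul, he, C_1]
  induction l using Nat.strong_induction_on generalizing P with
  | _ l ih =>
  obtain ⟨R, hR⟩ := rot_dvd e he i₀ a₀ b₀ ha₀ hb₀ hab₀ P h
  by_cases hl : l < 2
  · have h0 : ∀ a, a ≠ i₀ → pderiv a P = 0 := by
      intro a ha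
      have h1 := hP.pderiv (i := a)
      have : l - 1 = 0 := by omega
      rw [this, ← totalDegree_zero_iff_isHomogeneous, totalDegree_eq_zero_iff_eq_C] at h1
      have h2 : coeff 0 (pderiv a P) = 0 := by
        rw [hR a ha, ← constantCoeff_eq]; simp
      rw [h1, h2, C_0]
    obtain ⟨b, hb⟩ := eq_pow_of_pderiv_zero i₀ l P hP h0
    have : l / 2 = 0 := by omega
    exact ⟨fun _ => b, by rw [this]; simpa using hb⟩
  · obtain ⟨l, rfl⟩ : ∃ l', l = l' + 2 := ⟨l - 2, by omega⟩
    have hRh : R.IsHomogeneous l := by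
      intro m hm
      have h1 := hP.pderiv (i := a₀)
      have h2 : coeff (Finsupp.single a₀ 1 + m) (pderiv a₀ P) ≠ 0 := by
        rw [hR a₀ ha₀, mul_assoc, coeff_C_mul, coeff_X_mul]
        refine mul_ne_zero ?_ hm
        intro h0; have := he a₀; simp [h0] at this
      have h3 := h1 h2
      rw [map_add, Finsupp.weight_single] at h3
      simp at h3 ⊢
      omega
    have hRr : ∀ a b, a ≠ i₀ → b ≠ i₀ → a ≠ b →
        C (e b) * (X a * pderiv b R) = C (e a) * (X b * pderiv a R) := by
      intro a b ha hb hab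
      have h1 := pderiv_comm' P a b
      rw [hR a ha, hR b hb, mul_assoc, mul_assoc, pderiv_C_mul, pderiv_C_mul, pderiv_mul, pderiv_mul,
        pderiv_X_of_ne hab, pderiv_X_of_ne hab.symm] at h1
      linear_combination (-C (e a) * C (e b)) * h1 - C (e b) * X a * pderiv b R * hC a
        + C (e a) * X b * pderiv a R * hC b
    obtain ⟨r, hr⟩ := ih l (by omega) R hRh hRr
    set P' : MvPolynomial (Fin n) ℂ := ∑ k ∈ Finset.range (l / 2 + 1),
      C (r k / (2 * (k + 1))) * (Qp e i₀ ^ (k + 1) * X i₀ ^ (l - 2 * k)) with hP'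
    have hP'h : P'.IsHomogeneous (l + 2) := by
      refine IsHomogeneous.sum _ _ _ fun k hk => IsHomogeneous.C_mul ?_ _
      have := ((Qp_hom e i₀).pow (k + 1)).mul (isHomogeneous_X_pow (R := ℂ) i₀ (l - 2 * k))
      convert this using 1
      rw [Finset.mem_range] at hk
      omega
    obtain ⟨b, hb⟩ := eq_pow_of_pderiv_zero i₀ (l + 2) (P - P') (hP.sub hP'h) (by
      intro a ha
      rw [map_sub, hR a ha, sub_eq_zero, hP', map_sum, hr, Finset.mul_sum]
      refine Finset.sum_congr rfl fun k _ => ?_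
      rw [pderiv_C_mul, pderiv_term e i₀ a ha, ← mul_assoc (C _) (C _), ← C_mul]
      have : r k / (2 * (k + 1)) * (2 * (k + 1)) = r k := by
        have : (k + 1 : ℂ) ≠ 0 := by exact_mod_cast Nat.succ_ne_zero k
        field_simp
      rw [this]; ring)
    refine ⟨fun k => if k = 0 then b else r (k - 1) / (2 * (((k - 1 : ℕ) : ℂ) + 1)), ?_⟩
    have e1 : (l + 2) / 2 + 1 = (l / 2 + 1) + 1 := by omega
    rw [e1, Finset.sum_range_succ']
    rw [sub_eq_iff_eq_add'.mp hb, hP']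
    refine congrArg₂ (· + ·) ?_ ?_
    · refine Finset.sum_congr rfl fun k _ => ?_
      have e2 : l + 2 - 2 * (k + 1) = l - 2 * k := by omega
      simp [e2]
    · simp

theorem lap_term (e : Fin n → ℂ) (he : ∀ j, e j * e j = 1) (i₀ : Fin n) (k m : ℕ) :
    ∑ j, C (e j) * pderiv j (pderiv j (Qp e i₀ ^ k * X i₀ ^ m)) =
      C (2 * k * (n - 3 + 2 * k) : ℂ) * (Qp e i₀ ^ (k - 1) * X i₀ ^ m) +
      C (e i₀ * (m * (m - 1)) : ℂ) * (Qp e i₀ ^ k * X i₀ ^ (m - 2)) := by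
  have hC : ∀ j, (C (e j) * C (e j) : MvPolynomial (Fin n) ℂ) = 1 := by
    intro j; rw [← C_mul, he, C_1]
  have hC2 : (C 2 : MvPolynomial (Fin n) ℂ) = 2 := rfl
  rw [← Finset.sum_erase_add _ _ (Finset.mem_univ i₀)]
  congr 1
  · rcases k with _ | k
    · simp only [Nat.cast_zero, mul_zero, zero_mul, C_0]
      refine Finset.sum_eq_zero fun j hj => ?_
      have hj := Finset.ne_of_mem_erase hj
      rw [pderiv_mul, pderiv_pow]; simp [hj.symm]
    · have h1 : ∀ j ∈ Finset.univ.erase i₀,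
          C (e j) * pderiv j (pderiv j (Qp e i₀ ^ (k + 1) * X i₀ ^ m)) =
          C (2 * (k + 1) : ℂ) * (Qp e i₀ ^ k * X i₀ ^ m) +
          C (2 * (k + 1) : ℂ) * (C (2 * k : ℂ) * (Qp e i₀ ^ (k - 1) * X i₀ ^ m)) * (C (e j) * X j ^ 2) := by
        intro j hj
        have hj := Finset.ne_of_mem_erase hj
        rw [pderiv_term e i₀ j hj, mul_assoc (C (e j)) (X j), pderiv_C_mul, pderiv_C_mul, pderiv_mul,
          pderiv_X_self]
        rcases k with _ | k
        · rw [pderiv_mul, pderiv_pow, pderiv_pow]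
          simp [hj.symm, hC2]
          linear_combination (2 * X i₀ ^ m) * hC j
        · rw [pderiv_term e i₀ j hj]
          simp [hC2]
          linear_combination (2 * ((k:MvPolynomial (Fin n) ℂ) + 1 + 1) * (Qp e i₀ ^ (k + 1) * X i₀ ^ m)
            + 2 * (k + 1 + 1) * X j * (2 * (k+1)) * C (e j) * X j * (Qp e i₀ ^ k * X i₀ ^ m)) * hC j
      have hQ : ∑ j ∈ Finset.univ.erase i₀, (C (e j) * X j ^ 2 : MvPolynomial (Fin n) ℂ) = Qp e i₀ := rfl
      rw [Finset.sum_congr rfl h1, Finset.sum_add_distrib, Finset.sum_const,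
        Finset.card_erase_of_mem (Finset.mem_univ _), Finset.card_univ, Fintype.card_fin,
        nsmul_eq_mul, ← Finset.mul_sum, hQ]
      have hn : 1 ≤ n := by have := i₀.2; omega
      have h3 : (C 3 : MvPolynomial (Fin n) ℂ) = 3 := rfl
      rcases k with _ | k
      · push_cast [hn]
        simp [hC2, h3]; ring
      · push_cast [hn]
        simp [hC2, h3]; ring
  · rw [pderiv_mul, pderiv_pow, pderiv_Qp_self, pderiv_pow]
    rcases m with _ | _ | m
    · simp
    · simp only [mul_zero, zero_mul, zero_add, pderiv_X_self]
      simp [pderiv_pow, pderiv_Qp_self]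
    · simp [pderiv_mul, pderiv_pow, pderiv_Qp_self]
      ring
end part3
section part4
open MvPolynomial
variable {n : ℕ}

theorem eval_Qp (e : Fin n → ℂ) (i₀ a : Fin n) (ha : a ≠ i₀) (s : ℂ) :
    eval (fun i => if i = a then s else if i = i₀ then 1 else 0) (Qp e i₀) = e a * s ^ 2 := by
  unfold Qp
  rw [map_sum, Finset.sum_eq_single a]
  · simp
  · intro k hk hka; simp [hka, Finset.ne_of_mem_erase hk]
  · simp [ha]

theorem recursion (e : Fin n → ℂ) (he : ∀ j, e j * e j = 1) (i₀ a : Fin n) (ha : a ≠ i₀)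
    (u : ℂ) (l : ℕ) (hl : 1 ≤ l) (b : ℕ → ℂ) (P : MvPolynomial (Fin n) ℂ) (hP : P.IsHomogeneous l)
    (hb : P = ∑ k ∈ Finset.range (l / 2 + 1), C (b k) * (Qp e i₀ ^ k * X i₀ ^ (l - 2 * k)))
    (hs : C (2 * e a : ℂ) * (∑ j, X j * pderiv j (pderiv a P)) + C (2 * u * e a) * pderiv a P =
      X a * ∑ k, C (e k : ℂ) * pderiv k (pderiv k P)) :
    ∀ k < l / 2, 4 * (k + 1 : ℂ) * (l - 1 + u) * b (k + 1) =
      2 * (k + 1) * (n - 1 + 2 * k) * b (k + 1) + e i₀ * ((l - 2 * k) * (l - 2 * k - 1)) * b k := by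
  have hC : ∀ j, (C (e j) * C (e j) : MvPolynomial (Fin n) ℂ) = 1 := by
    intro j; rw [← C_mul, he, C_1]
  set K := l / 2 with hK
  have hA : pderiv a P = C (e a) * X a * ∑ k ∈ Finset.range K,
      C (2 * (k + 1) * b (k + 1) : ℂ) * (Qp e i₀ ^ k * X i₀ ^ (l - 2 * (k + 1))) := by
    rw [hb, map_sum, Finset.sum_range_succ', Finset.mul_sum]
    have : pderiv a (C (b 0) * (Qp e i₀ ^ 0 * X i₀ ^ (l - 2 * 0))) = 0 := by
      rw [pderiv_C_mul, pow_zero, one_mul, pderiv_pow, pderiv_X_of_ne ha.symm, mul_zero, mul_zero]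
    rw [this, add_zero]
    refine Finset.sum_congr rfl fun k _ => ?_
    rw [pderiv_C_mul, pderiv_term e i₀ a ha, C_mul (a' := b (k + 1))]
    ring
  have hB : ∑ j, C (e j) * pderiv j (pderiv j P) = ∑ k ∈ Finset.range K,
      C (2 * (k + 1) * (n - 1 + 2 * k) * b (k + 1) + e i₀ * ((l - 2 * k) * (l - 2 * k - 1)) * b k : ℂ)
        * (Qp e i₀ ^ k * X i₀ ^ (l - 2 * (k + 1))) := by
    have h1 : ∑ j, C (e j) * pderiv j (pderiv j P) = ∑ k ∈ Finset.range (K + 1), C (b k) *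
        ∑ j, C (e j) * pderiv j (pderiv j (Qp e i₀ ^ k * X i₀ ^ (l - 2 * k))) := by
      rw [hb]
      simp only [map_sum, pderiv_C_mul, Finset.mul_sum]
      rw [Finset.sum_comm]
      refine Finset.sum_congr rfl fun _ _ => Finset.sum_congr rfl fun _ _ => by ring
    rw [h1]
    simp only [lap_term e he]
    rw [Finset.sum_congr rfl (fun k _ => mul_add (C (b k)) _ _), Finset.sum_add_distrib]
    rw [Finset.sum_range_succ', Finset.sum_range_succ _ K]
    have h2 : C (b K) * (C (e i₀ * ((((l - 2 * K : ℕ) : ℂ)) * (((l - 2 * K : ℕ) : ℂ) - 1))) *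
        (Qp e i₀ ^ K * X i₀ ^ (l - 2 * K - 2))) = 0 := by
      have : l - 2 * K = 0 ∨ l - 2 * K = 1 := by omega
      rcases this with h | h <;> simp [h]
    rw [h2, add_zero]
    simp only [Nat.cast_zero, mul_zero, zero_mul, C_0, add_zero]
    rw [← Finset.sum_add_distrib]
    refine Finset.sum_congr rfl fun k hk => ?_
    rw [Finset.mem_range] at hk
    have e1 : l - 2 * k - 2 = l - 2 * (k + 1) := by omega
    have e2 : ((l - 2 * k : ℕ) : ℂ) = l - 2 * k := by
      rw [Nat.cast_sub (by omega)]; push_cast; ring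
    have hh : ∀ (x y z w : ℂ) (T : MvPolynomial (Fin n) ℂ),
        C x * (C y * T) + C z * (C w * T) = C (x * y + z * w) * T := by
      intros; simp only [C_add, C_mul]; ring
    rw [e1, e2, Nat.add_sub_cancel, hh]
    congr 2
    push_cast; ring
  rw [hP.pderiv.sum_X_mul_pderiv, hA, hB] at hs
  have hcast : ((l - 1 : ℕ) : MvPolynomial (Fin n) ℂ) = C ((l : ℂ) - 1) := by
    rw [← map_natCast C (l - 1), Nat.cast_sub hl, Nat.cast_one]
  rw [nsmul_eq_mul, hcast] at hs
  have hs2 : X a * (C (2 * (l - 1 + u) : ℂ) * ∑ k ∈ Finset.range K,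
      C (2 * (k + 1) * b (k + 1) : ℂ) * (Qp e i₀ ^ k * X i₀ ^ (l - 2 * (k + 1)))) =
      X a * ∑ k ∈ Finset.range K,
      C (2 * (k + 1) * (n - 1 + 2 * k) * b (k + 1) + e i₀ * ((l - 2 * k) * (l - 2 * k - 1)) * b k : ℂ)
        * (Qp e i₀ ^ k * X i₀ ^ (l - 2 * (k + 1))) := by
    rw [← hs]
    generalize (∑ k ∈ Finset.range K,
      C (2 * (k + 1) * b (k + 1) : ℂ) * (Qp e i₀ ^ k * X i₀ ^ (l - 2 * (k + 1)))) = S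
    have h2 : (C 2 : MvPolynomial (Fin n) ℂ) = 2 := rfl
    simp only [C_mul, C_add, C_sub, h2]
    linear_combination (-(2 * (C (l:ℂ) - C 1 + C u) * X a * S)) * hC a
  have hs3 := mul_left_cancel₀ (X_ne_zero a) hs2
  have hp : (∑ k ∈ Finset.range K, Polynomial.C (2 * (l - 1 + u) * (2 * (k + 1) * b (k + 1)) -
      (2 * (k + 1) * (n - 1 + 2 * k) * b (k + 1) + e i₀ * ((l - 2 * k) * (l - 2 * k - 1)) * b k) : ℂ)
        * Polynomial.X ^ k : Polynomial ℂ) = 0 := by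
    refine Polynomial.funext fun t => ?_
    obtain ⟨s, hst⟩ := IsAlgClosed.exists_pow_nat_eq (e a * t) (n := 2) (by norm_num)
    have h4 := congrArg (eval (fun i => if i = a then s else if i = i₀ then 1 else 0)) hs3
    have h5 : e a * (e a * t) = t := by rw [← mul_assoc, he, one_mul]
    simp only [map_mul, map_sum, map_pow, eval_Qp e i₀ a ha, eval_C, eval_X, hst, h5, ha.symm, if_false, if_true, one_pow,
      mul_one] at h4
    rw [← sub_eq_zero, Finset.mul_sum, ← Finset.sum_sub_distrib] at h4
    rw [Polynomial.eval_finset_sum, Polynomial.eval_zero, ← h4]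
    refine Finset.sum_congr rfl fun k _ => ?_
    simp only [Polynomial.eval_mul, Polynomial.eval_C, Polynomial.eval_pow, Polynomial.eval_X]
    ring
  intro k hk
  have h6 := congrArg (fun p => Polynomial.coeff p k) hp
  simp only [Polynomial.finset_sum_coeff, Polynomial.coeff_C_mul_X_pow, Polynomial.coeff_zero] at h6
  rw [Finset.sum_ite_eq, if_pos (Finset.mem_range.mpr hk)] at h6
  linear_combination h6

theorem akCoeff_rec (μ : ℂ) (l k : ℕ) (hk : k < l / 2) :
    4 * (k + 1 : ℂ) * (μ + (l - k - 1)) * akCoeff μ l (k + 1) =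
      - ((l - 2 * k) * (l - 2 * k - 1)) * akCoeff μ l k := by
  obtain ⟨r, rfl⟩ : ∃ r, l = r + 2 * (k + 1) := ⟨l - 2 * (k + 1), by omega⟩
  unfold akCoeff
  have e1 : r + 2 * (k + 1) - 2 * (k + 1) = r := by omega
  have e2 : r + 2 * (k + 1) - 2 * k = r + 2 := by omega
  have e3 : r + 2 * (k + 1) - (k + 1) = r + k + 1 := by omega
  have e4 : r + 2 * (k + 1) - k = r + k + 1 + 1 := by omega
  rw [e1, e2, e3, e4, Finset.prod_Ico_succ_top (a := (r + 2 * (k + 1) + 1) / 2) (b := r + k + 1) (by omega)]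
  generalize (∏ j ∈ Finset.Ico ((r + 2 * (k + 1) + 1) / 2) (r + k + 1), (μ + (j : ℂ))) = p
  rw [Nat.factorial_succ k, Nat.factorial_succ (r + 1), Nat.factorial_succ r]
  have h1 : ((k : ℂ) + 1) ≠ 0 := Nat.cast_add_one_ne_zero k
  have h2 : ((r : ℂ) + 1) ≠ 0 := Nat.cast_add_one_ne_zero r
  have h3 : ((r : ℂ) + 1 + 1) ≠ 0 := by exact_mod_cast Nat.succ_ne_zero (r + 1)
  have h4 : (k.factorial : ℂ) ≠ 0 := by exact_mod_cast Nat.factorial_ne_zero k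
  have h5 : (r.factorial : ℂ) ≠ 0 := by exact_mod_cast Nat.factorial_ne_zero r
  push_cast
  field_simp
  ring

theorem akCoeff_top (μ : ℂ) (l : ℕ) : akCoeff μ l (l / 2) ≠ 0 := by
  unfold akCoeff
  rw [Finset.Ico_eq_empty (by omega), Finset.prod_empty, mul_one]
  refine div_ne_zero (mul_ne_zero (pow_ne_zero _ (by norm_num)) (pow_ne_zero _ (by norm_num))) ?_
  exact_mod_cast mul_ne_zero (Nat.factorial_ne_zero _) (Nat.factorial_ne_zero _)

theorem coeffs_eq (μ : ℂ) (l : ℕ) (b : ℕ → ℂ) (ε : ℂ) (hε : ε * ε = 1)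
    (h : ∀ k < l / 2, 4 * (k + 1 : ℂ) * (μ + (l - k - 1)) * b (k + 1) =
      ε * ((l - 2 * k) * (l - 2 * k - 1)) * b k) :
    ∃ c, ∀ k ≤ l / 2, b k = c * (akCoeff μ l k * (-ε) ^ k) := by
  have hε0 : -ε ≠ 0 := by
    intro h0
    have : ε = 0 := by linear_combination -h0
    simp [this] at hε
  have ht : akCoeff μ l (l / 2) * (-ε) ^ (l / 2) ≠ 0 := mul_ne_zero (akCoeff_top μ l) (pow_ne_zero _ hε0)
  refine ⟨b (l / 2) / (akCoeff μ l (l / 2) * (-ε) ^ (l / 2)), fun k hk => ?_⟩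
  induction hk using Nat.decreasingInduction with
  | self => exact (div_mul_cancel₀ _ ht).symm
  | of_succ k hk ih =>
    set c := b (l / 2) / (akCoeff μ l (l / 2) * (-ε) ^ (l / 2))
    have h1 := h k hk
    have h2 := akCoeff_rec μ l k hk
    rw [ih] at h1
    have h3 : ((l : ℂ) - 2 * k) * (l - 2 * k - 1) ≠ 0 := by
      obtain ⟨r, rfl⟩ : ∃ r, l = r + 2 * (k + 1) := ⟨l - 2 * (k + 1), by omega⟩
      have h2 : ((r : ℂ) + 1) ≠ 0 := Nat.cast_add_one_ne_zero r
      have h3 : ((r : ℂ) + 1 + 1) ≠ 0 := by exact_mod_cast Nat.succ_ne_zero (r + 1)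
      have := mul_ne_zero h3 h2
      push_cast
      convert this using 1
      ring
    refine mul_left_cancel₀ h3 ?_
    linear_combination (-ε) * h1 + (-ε) * c * (-ε) ^ k * ε * h2
      + ((l : ℂ) - 2 * k) * (l - 2 * k - 1) * (c * akCoeff μ l k * (-ε) ^ k - b k) * hε
end part4
theorem stmt3 (n : ℕ) (hn : 3 ≤ n) (ε : Fin n → ℝ) (hε : ∀ j, ε j = 1 ∨ ε j = -1)
    (u v : ℂ) (P : MvPolynomial (Fin n) ℂ) (hP : P ≠ 0)
    (hcov : IsCovariantSymbol ε ⟨n - 1, by omega⟩ u v P) :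
    ∃ ℓ : ℕ, v - u = (ℓ : ℂ) ∧ ∃ c : ℂ, c ≠ 0 ∧
      P = c • juhlSymbol ε ⟨n - 1, by omega⟩ (u - ((n : ℂ) - 1) / 2) ℓ := by
  classical
  set i₀ : Fin n := ⟨n - 1, by omega⟩ with hi₀
  set e : Fin n → ℂ := fun j => (ε j : ℂ) with he_def
  have he : ∀ j, e j * e j = 1 := by
    intro j
    rcases hε j with h | h <;> simp [he_def, h]
  obtain ⟨m, hm⟩ := MvPolynomial.ne_zero_iff.mp hP
  have hdeg := cov_dil ε i₀ u v P hcov m hm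
  refine ⟨m.degree, hdeg, ?_⟩
  set l := m.degree with hl
  have hhom : P.IsHomogeneous l := by
    intro m' hm'
    have h1 := cov_dil ε i₀ u v P hcov m' hm'
    rw [hdeg] at h1
    have h2 : l = m'.degree := by exact_mod_cast h1
    rw [h2, Finsupp.degree_eq_weight_one]; rfl
  have ha : (⟨0, by omega⟩ : Fin n) ≠ i₀ := by
    rw [hi₀, Ne, Fin.mk.injEq]; omega
  have hb : (⟨1, by omega⟩ : Fin n) ≠ i₀ := by
    rw [hi₀, Ne, Fin.mk.injEq]; omega
  obtain ⟨b, hbP⟩ := structure_lem e he i₀ ⟨0, by omega⟩ ⟨1, by omega⟩ ha hb (by simp) l P hhom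
    (fun a b ha hb hab => cov_rot ε i₀ u v P hcov a b ha hb hab)
  have hrec : ∀ k < l / 2, 4 * (k + 1 : ℂ) * ((u - ((n : ℂ) - 1) / 2) + (l - k - 1)) * b (k + 1) =
      e i₀ * ((l - 2 * k) * (l - 2 * k - 1)) * b k := by
    intro k hk
    have := recursion e he i₀ ⟨0, by omega⟩ ha u l (by omega) b P hhom hbP
      (cov_spec ε hε i₀ u v P hcov _ ha) k hk
    linear_combination this
  obtain ⟨c, hc⟩ := coeffs_eq _ l b (e i₀) (he i₀) hrec
  have hfin : P = c • juhlSymbol ε i₀ (u - ((n : ℂ) - 1) / 2) l := by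
    rw [hbP, juhlSymbol, Finset.smul_sum]
    refine Finset.sum_congr rfl fun k hk => ?_
    rw [hc k (by rw [Finset.mem_range] at hk; omega), MvPolynomial.smul_eq_C_mul]
    simp only [Qp, MvPolynomial.C_mul, MvPolynomial.C_pow, mul_pow, he_def]
    ring
  refine ⟨c, ?_, hfin⟩
  rintro rfl
  rw [zero_smul] at hfin
  exact hP hfin
end
end

section
/- Let n ≥ 3, let ε, ε′ ∈ {−1,1}^n be two sign vectors, and let u, v ∈ ℂ. Then there exists a nonzero (ε,u,v)-covariant symbol if and only if there exists a nonzero (ε′,u,v)-covariant symbol. In particular, the existence of nonzero scalar conformal symmetry breaking operators of the form Rest_{x_n=0} ∘ P(∂) is independent of the signature (p,q) with p + q = n. (Scalar case i = j = 0 of Theorem B(2): all the spaces of conformal symmetry breaking operators for the pairs (ℝ^{p,q}, hyperplane) with p+q = n are isomorphic.) -/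
open scoped BigOperators

noncomputable section

abbrev Sm {n : ℕ} {E : Type} [NormedAddCommGroup E] [NormedSpace ℝ E]
    (f : (Fin n → ℝ) → E) : Prop := ContDiff ℝ (⊤ : ℕ∞) f

section basic
variable {n : ℕ} {E : Type} [NormedAddCommGroup E] [NormedSpace ℝ E]

lemma Sm.diff {f : (Fin n → ℝ) → E} (hf : Sm f) : Differentiable ℝ f :=
  ContDiff.differentiable hf (by simp)

lemma Sm.fd {f : (Fin n → ℝ) → E} (hf : Sm f) : ContDiff ℝ (⊤ : ℕ∞) (fderiv ℝ f) :=
  ContDiff.fderiv_right hf (by simp)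

lemma Sm.pd {f : (Fin n → ℝ) → E} (hf : Sm f) (j : Fin n) : Sm (pd j f) := by
  unfold _root_.pd
  exact (Sm.fd hf).clm_apply contDiff_const

lemma pd_comm {f : (Fin n → ℝ) → E} (hf : Sm f) (j k : Fin n) :
    pd j (pd k f) = pd k (pd j f) := by
  funext x
  have h1 : ∀ a b : Fin n, pd a (pd b f) x
      = fderiv ℝ (fderiv ℝ f) x (Pi.single a 1) (Pi.single b 1) := by
    intro a b
    unfold pd
    rw [fderiv_clm_apply ((Sm.fd hf).differentiable (by simp) x) (by fun_prop)]
    simp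
  rw [h1, h1]
  have := (hf.contDiffAt (x := x)).isSymmSndFDerivAt (by
    simp only [minSmoothness_of_isRCLikeNormedField]
    exact WithTop.coe_le_coe.2 le_top)
  exact this.eq _ _

lemma pd_add {f g : (Fin n → ℝ) → E} (hf : Sm f) (hg : Sm g) (j : Fin n) :
    pd j (fun y => f y + g y) = fun y => pd j f y + pd j g y := by
  funext x
  unfold pd
  rw [fderiv_fun_add (hf.diff x) (hg.diff x)]; simp

lemma pd_sum {ι : Type} (s : Finset ι) {f : ι → (Fin n → ℝ) → E} (hf : ∀ i, Sm (f i))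
    (j : Fin n) :
    pd j (fun y => ∑ i ∈ s, f i y) = fun y => ∑ i ∈ s, pd j (f i) y := by
  funext x
  unfold pd
  rw [fderiv_fun_sum (fun i _ => (hf i).diff x)]; simp

lemma pd_mul {f g : (Fin n → ℝ) → ℂ} (hf : Sm f) (hg : Sm g) (j : Fin n) :
    pd j (fun y => f y * g y) = fun y => pd j f y * g y + f y * pd j g y := by
  funext x
  unfold pd
  rw [fderiv_fun_mul (hf.diff x) (hg.diff x)]; simp; ring

lemma pd_mulR {f g : (Fin n → ℝ) → ℝ} (hf : Sm f) (hg : Sm g) (j : Fin n) :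
    pd j (fun y => f y * g y) = fun y => pd j f y * g y + f y * pd j g y := by
  funext x
  unfold pd
  rw [fderiv_fun_mul (hf.diff x) (hg.diff x)]; simp; ring

lemma pd_const (c : E) (j : Fin n) : pd j (fun _ : Fin n → ℝ => c) = fun _ => 0 := by
  funext x; unfold pd; simp

lemma pd_cmul {f : (Fin n → ℝ) → ℂ} (c : ℂ) (hf : Sm f) (j : Fin n) :
    pd j (fun y => c * f y) = fun y => c * pd j f y := by
  rw [pd_mul contDiff_const hf, pd_const]; simp

lemma pd_cmulR {f : (Fin n → ℝ) → ℝ} (c : ℝ) (hf : Sm f) (j : Fin n) :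
    pd j (fun y => c * f y) = fun y => c * pd j f y := by
  rw [pd_mulR contDiff_const hf, pd_const]; simp

lemma pd_coord (i j : Fin n) :
    pd j (fun y : Fin n → ℝ => y i) = fun _ => if i = j then 1 else 0 := by
  funext x
  unfold pd
  have : (fun y : Fin n → ℝ => y i) = (ContinuousLinearMap.proj (R := ℝ) (φ := fun _ : Fin n => ℝ) i) := rfl
  rw [this, ContinuousLinearMap.fderiv]
  simp [Pi.single_apply]

lemma Sm.ofReal {f : (Fin n → ℝ) → ℝ} (hf : Sm f) : Sm (fun y => (f y : ℂ)) :=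
  Complex.ofRealCLM.contDiff.comp hf

lemma pd_ofReal {f : (Fin n → ℝ) → ℝ} (hf : Sm f) (j : Fin n) :
    pd j (fun y => (f y : ℂ)) = fun y => ((pd j f y : ℝ) : ℂ) := by
  funext x
  unfold pd
  have := (Complex.ofRealCLM.hasFDerivAt.comp x (hf.diff x).hasFDerivAt).fderiv
  have h2 : (fun y => (f y : ℂ)) = Complex.ofRealCLM ∘ f := rfl
  rw [h2, this]; simp

lemma pd_tangent {g : (Fin n → ℝ) → ℝ} (hg : Sm g) {i₀ k : Fin n} (hk : k ≠ i₀)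
    (h : ∀ x : Fin n → ℝ, x i₀ = 0 → g x = 0) :
    ∀ x : Fin n → ℝ, x i₀ = 0 → pd k g x = 0 := by
  intro x hx
  unfold pd
  rw [← (hg.diff x).lineDeriv_eq_fderiv]
  unfold lineDeriv
  have : (fun t : ℝ => g (x + t • Pi.single k 1)) = fun _ => 0 := by
    funext t
    apply h
    simp [hx, Pi.single_apply, hk.symm]
  rw [this]; simp

/-! iterated -/

lemma Sm.iter {f : (Fin n → ℝ) → E} (hf : Sm f) (j : Fin n) (k : ℕ) : Sm ((_root_.pd j)^[k] f) := by
  induction k with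
  | zero => exact hf
  | succ k ih => rw [Function.iterate_succ_apply']; exact ih.pd j

lemma pd_iter_comm {f : (Fin n → ℝ) → E} (hf : Sm f) (i j : Fin n) (k : ℕ) :
    pd i ((pd j)^[k] f) = (pd j)^[k] (pd i f) := by
  induction k with
  | zero => rfl
  | succ k ih =>
    rw [Function.iterate_succ_apply', Function.iterate_succ_apply', ← ih]
    exact pd_comm (hf.iter j k) i j

def mdl (l : List (Fin n)) (m : Fin n → ℕ) (f : (Fin n → ℝ) → ℂ) : (Fin n → ℝ) → ℂ :=
  l.foldr (fun j g => (pd j)^[m j] g) f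

lemma mdl_smooth (l : List (Fin n)) (m : Fin n → ℕ) {f : (Fin n → ℝ) → ℂ} (hf : Sm f) :
    Sm (mdl l m f) := by
  induction l with
  | nil => exact hf
  | cons a l ih => exact Sm.iter ih a (m a)

lemma mdl_not_mem (l : List (Fin n)) (m : Fin n → ℕ) (j : Fin n) (hj : j ∉ l)
    (f : (Fin n → ℝ) → ℂ) :
    mdl l (fun i => m i + if i = j then 1 else 0) f = mdl l m f := by
  induction l with
  | nil => rfl
  | cons a l ih =>
    simp only [List.mem_cons, not_or] at hj
    have := ih hj.2
    unfold mdl at this ⊢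
    simp only [List.foldr_cons]
    rw [this]
    simp [Ne.symm hj.1]

lemma mdl_mem (l : List (Fin n)) (hl : l.Nodup) (m : Fin n → ℕ) (j : Fin n) (hj : j ∈ l)
    {f : (Fin n → ℝ) → ℂ} (hf : Sm f) :
    mdl l (fun i => m i + if i = j then 1 else 0) f = pd j (mdl l m f) := by
  induction l with
  | nil => simp at hj
  | cons a l ih =>
    rw [List.nodup_cons] at hl
    have hc : ∀ m' : Fin n → ℕ, mdl (a :: l) m' f = (pd a)^[m' a] (mdl l m' f) := fun _ => rfl
    rw [hc, hc]
    by_cases h : a = j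
    · subst h
      rw [mdl_not_mem l m a hl.1]
      simp only [if_true]
      rw [Function.iterate_succ_apply']
    · have hj' : j ∈ l := by
        rcases List.mem_cons.1 hj with h' | h'
        · exact absurd h'.symm h
        · exact h'
      rw [ih hl.2 hj']
      simp only [h, if_false, add_zero]
      rw [pd_iter_comm (mdl_smooth l m hf)]

lemma mdl_pd (l : List (Fin n)) (m : Fin n → ℕ) (j : Fin n)
    {f : (Fin n → ℝ) → ℂ} (hf : Sm f) :
    mdl l m (pd j f) = pd j (mdl l m f) := by
  induction l with
  | nil => rfl
  | cons a l ih =>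
    have hc : ∀ f, mdl (a :: l) m f = (pd a)^[m a] (mdl l m f) := fun _ => rfl
    rw [hc, hc, ih, pd_iter_comm (mdl_smooth l m hf)]

lemma monoDiff_eq (m : Fin n → ℕ) (f : (Fin n → ℝ) → ℂ) :
    monoDiff m f = mdl (List.finRange n) m f := rfl

lemma monoDiff_smooth (m : Fin n → ℕ) {f : (Fin n → ℝ) → ℂ} (hf : Sm f) :
    Sm (monoDiff m f) := mdl_smooth _ m hf

lemma monoDiff_succ (m : Fin n →₀ ℕ) (j : Fin n) {f : (Fin n → ℝ) → ℂ} (hf : Sm f) :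
    monoDiff (fun i => (m + Finsupp.single j 1 : Fin n →₀ ℕ) i) f
      = pd j (monoDiff (fun i => m i) f) := by
  rw [monoDiff_eq, monoDiff_eq, ← mdl_mem _ (List.nodup_finRange n) _ _ (List.mem_finRange j) hf]
  congr 1
  funext i
  simp [Finsupp.single_apply, eq_comm]

lemma polyDiff_subset (P : MvPolynomial (Fin n) ℂ) (f : (Fin n → ℝ) → ℂ) (x : Fin n → ℝ)
    (s : Finset (Fin n →₀ ℕ)) (hs : P.support ⊆ s) :
    polyDiff P f x = ∑ m ∈ s, P.coeff m * monoDiff (fun j => m j) f x := by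
  unfold polyDiff
  apply Finset.sum_subset hs
  intro m _ hm
  rw [MvPolynomial.notMem_support_iff.1 hm, zero_mul]

/-- `polyDiff` as linear map in the symbol. -/
def pdl (f : (Fin n → ℝ) → ℂ) (x : Fin n → ℝ) : MvPolynomial (Fin n) ℂ →ₗ[ℂ] ℂ where
  toFun P := polyDiff P f x
  map_add' P Q := by
    classical
    rw [polyDiff_subset (P + Q) f x (P.support ∪ Q.support) MvPolynomial.support_add,
      polyDiff_subset P f x (P.support ∪ Q.support) Finset.subset_union_left,
      polyDiff_subset Q f x (P.support ∪ Q.support) Finset.subset_union_right,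
      ← Finset.sum_add_distrib]
    simp [add_mul]
  map_smul' c P := by
    rw [polyDiff_subset (c • P) f x P.support MvPolynomial.support_smul]
    simp [polyDiff, Finset.mul_sum, mul_assoc]

lemma pdl_apply (f : (Fin n → ℝ) → ℂ) (x : Fin n → ℝ) (P : MvPolynomial (Fin n) ℂ) :
    pdl f x P = polyDiff P f x := rfl

lemma pdl_C_mul (f : (Fin n → ℝ) → ℂ) (x : Fin n → ℝ) (c : ℂ) (P : MvPolynomial (Fin n) ℂ) :
    pdl f x (MvPolynomial.C c * P) = c * pdl f x P := by
  rw [← MvPolynomial.smul_eq_C_mul, map_smul, smul_eq_mul]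

lemma pdl_monomial (f : (Fin n → ℝ) → ℂ) (x : Fin n → ℝ) (m : Fin n →₀ ℕ) (c : ℂ) :
    pdl f x (MvPolynomial.monomial m c) = c * monoDiff (fun j => m j) f x := by
  classical
  rw [pdl_apply, polyDiff_subset _ f x {m} MvPolynomial.support_monomial_subset]
  simp

lemma pdl_C (f : (Fin n → ℝ) → ℂ) (x : Fin n → ℝ) (c : ℂ) :
    pdl f x (MvPolynomial.C c) = c * f x := by
  rw [← MvPolynomial.monomial_zero', pdl_monomial]
  congr 1
  rw [monoDiff_eq]
  have : ∀ l : List (Fin n), mdl l (fun j => (0 : Fin n →₀ ℕ) j) f = f := by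
    intro l
    induction l with
    | nil => rfl
    | cons a l ih => exact ih
  rw [this]

lemma polyDiff_smooth (P : MvPolynomial (Fin n) ℂ) {f : (Fin n → ℝ) → ℂ} (hf : Sm f) :
    Sm (polyDiff P f) := by
  unfold polyDiff
  apply ContDiff.sum
  intro m _
  exact contDiff_const.mul (mdl_smooth _ _ hf)

lemma pdl_smooth (P : MvPolynomial (Fin n) ℂ) {f : (Fin n → ℝ) → ℂ} (hf : Sm f) :
    Sm (fun y => pdl f y P) := polyDiff_smooth P hf

lemma pd_pdl (P : MvPolynomial (Fin n) ℂ) {f : (Fin n → ℝ) → ℂ} (hf : Sm f) (j : Fin n)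
    (x : Fin n → ℝ) :
    pd j (fun y => pdl f y P) x = pdl f x (MvPolynomial.X j * P) := by
  induction P using MvPolynomial.induction_on' generalizing x with
  | monomial m c =>
    rw [mul_comm, MvPolynomial.X, MvPolynomial.monomial_mul, pdl_monomial, monoDiff_succ m j hf]
    simp only [pdl_monomial]
    rw [pd_cmul c (monoDiff_smooth _ hf), mul_one]
  | add P Q hP hQ =>
    simp only [map_add, mul_add]
    simp only [pd_add (pdl_smooth P hf) (pdl_smooth Q hf), hP, hQ]

lemma pdl_pd (P : MvPolynomial (Fin n) ℂ) {f : (Fin n → ℝ) → ℂ} (hf : Sm f) (j : Fin n)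
    (x : Fin n → ℝ) :
    pdl (pd j f) x P = pdl f x (MvPolynomial.X j * P) := by
  rw [← pd_pdl P hf]
  induction P using MvPolynomial.induction_on' generalizing x with
  | monomial m c =>
    simp only [pdl_monomial]
    rw [pd_cmul c (monoDiff_smooth _ hf), monoDiff_eq, mdl_pd _ _ _ hf, monoDiff_eq]
  | add P Q hP hQ =>
    simp only [map_add]
    simp only [pd_add (pdl_smooth P hf) (pdl_smooth Q hf), hP, hQ]

lemma pdl_add_fun (P : MvPolynomial (Fin n) ℂ) {f g : (Fin n → ℝ) → ℂ} (hf : Sm f) (hg : Sm g)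
    (x : Fin n → ℝ) : pdl (fun y => f y + g y) x P = pdl f x P + pdl g x P := by
  have hs : Sm (fun y => f y + g y) := ContDiff.add hf hg
  induction P using MvPolynomial.induction_on generalizing x with
  | C c => simp only [pdl_C]; ring
  | add P Q hP hQ => simp only [map_add, hP, hQ]; ring
  | mul_X P j hP =>
    rw [mul_comm, ← pd_pdl P hs, ← pd_pdl P hf, ← pd_pdl P hg]
    simp only [hP]
    rw [pd_add (pdl_smooth P hf) (pdl_smooth P hg)]

lemma pdl_cmul_fun (P : MvPolynomial (Fin n) ℂ) {f : (Fin n → ℝ) → ℂ} (c : ℂ) (hf : Sm f)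
    (x : Fin n → ℝ) : pdl (fun y => c * f y) x P = c * pdl f x P := by
  have hs : Sm (fun y => c * f y) := ContDiff.mul contDiff_const hf
  induction P using MvPolynomial.induction_on generalizing x with
  | C c => simp only [pdl_C]; ring
  | add P Q hP hQ => simp only [map_add, hP, hQ]; ring
  | mul_X P j hP =>
    rw [mul_comm, ← pd_pdl P hs, ← pd_pdl P hf]
    simp only [hP]
    rw [pd_cmul _ (pdl_smooth P hf)]

lemma pdl_sum_fun {ι : Type} (s : Finset ι) (P : MvPolynomial (Fin n) ℂ)
    {f : ι → (Fin n → ℝ) → ℂ} (hf : ∀ i, Sm (f i))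
    (x : Fin n → ℝ) : pdl (fun y => ∑ i ∈ s, f i y) x P = ∑ i ∈ s, pdl (f i) x P := by
  classical
  induction s using Finset.induction_on with
  | empty =>
    simp only [Finset.sum_empty]
    have := pdl_cmul_fun P (f := fun _ : Fin n → ℝ => 0) 0 contDiff_const x
    simpa using this
  | insert a s ha ih =>
    simp only [Finset.sum_insert ha]
    rw [pdl_add_fun P (hf a) (ContDiff.sum fun i _ => hf i), ih]

open MvPolynomial in
/-- Leibniz rule for a quadratic multiplier. -/
lemma leibniz (P : MvPolynomial (Fin n) ℂ) {a f : (Fin n → ℝ) → ℂ} (ha : Sm a) (hf : Sm f)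
    (h3 : ∀ k l m : Fin n, ∀ y, pd m (pd l (pd k a)) y = 0) (x : Fin n → ℝ) :
    pdl (fun y => a y * f y) x P = a x * pdl f x P
      + ∑ k, pd k a x * pdl f x (pderiv k P)
      + 1 / 2 * ∑ k, ∑ l, pd l (pd k a) x * pdl f x (pderiv l (pderiv k P)) := by
  have hs : Sm (fun y => a y * f y) := ContDiff.mul ha hf
  induction P using MvPolynomial.induction_on generalizing x with
  | C c => simp [pdl_C]; ring
  | add P Q hP hQ =>
    simp only [map_add, hP, hQ, mul_add, Finset.sum_add_distrib]; ring
  | mul_X P j hP =>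
    rw [mul_comm, ← pd_pdl P hs]
    simp only [hP]
    have s1 : Sm (fun y => a y * pdl f y P) := ContDiff.mul ha (pdl_smooth P hf)
    have s2 : ∀ k, Sm (fun y => pd k a y * pdl f y (pderiv k P)) :=
      fun k => ContDiff.mul (ha.pd k) (pdl_smooth _ hf)
    have s3 : ∀ k l, Sm (fun y => pd l (pd k a) y * pdl f y (pderiv l (pderiv k P))) :=
      fun k l => ContDiff.mul ((ha.pd k).pd l) (pdl_smooth _ hf)
    have s2' : Sm (fun y => ∑ k, pd k a y * pdl f y (pderiv k P)) := ContDiff.sum fun k _ => s2 k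
    have s3'' : ∀ k, Sm (fun y => ∑ l, pd l (pd k a) y * pdl f y (pderiv l (pderiv k P))) :=
      fun k => ContDiff.sum fun l _ => s3 k l
    have s3' : Sm (fun y => ∑ k, ∑ l, pd l (pd k a) y * pdl f y (pderiv l (pderiv k P))) :=
      ContDiff.sum fun k _ => s3'' k
    have s12 : Sm (fun y => a y * pdl f y P + ∑ k, pd k a y * pdl f y (pderiv k P)) :=
      ContDiff.add s1 s2'
    rw [pd_add s12 (ContDiff.mul contDiff_const s3'), pd_add s1 s2',
      pd_cmul _ s3', pd_sum _ s2, pd_sum _ s3'', pd_mul ha (pdl_smooth P hf)]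
    have e2 : ∀ k, pd j (fun y => pd k a y * pdl f y (pderiv k P)) x
        = pd j (pd k a) x * pdl f x (pderiv k P) + pd k a x * pdl f x (X j * pderiv k P) := by
      intro k
      rw [pd_mul (ha.pd k) (pdl_smooth _ hf)]
      simp only [pd_pdl _ hf]
    have e3 : ∀ k, pd j (fun y => ∑ l, pd l (pd k a) y * pdl f y (pderiv l (pderiv k P))) x
        = ∑ l, pd l (pd k a) x * pdl f x (X j * pderiv l (pderiv k P)) := by
      intro k
      rw [pd_sum _ (s3 k)]
      apply Finset.sum_congr rfl
      intro l _
      rw [pd_mul ((ha.pd k).pd l) (pdl_smooth _ hf)]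
      simp only [pd_pdl _ hf, h3]; ring
    simp only [e2, e3, pd_pdl _ hf]
    have d1 : ∀ k, pdl f x (pderiv k (X j * P))
        = (if k = j then pdl f x P else 0) + pdl f x (X j * pderiv k P) := by
      intro k
      rw [Derivation.leibniz, pderiv_X, map_add]
      by_cases h : k = j
      · subst h; simp [add_comm]
      · simp [h, Pi.single_apply, Ne.symm h]
    have d2 : ∀ k l, pdl f x (pderiv l (pderiv k (X j * P)))
        = (if k = j then pdl f x (pderiv l P) else 0) + (if l = j then pdl f x (pderiv k P) else 0)
          + pdl f x (X j * pderiv l (pderiv k P)) := by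
      intro k l
      rw [Derivation.leibniz, pderiv_X, map_add, map_add]
      by_cases h : k = j
      · subst h
        by_cases h' : l = k
        · subst h'; simp; ring
        · simp [h', Pi.single_apply, Ne.symm h']; ring
      · by_cases h' : l = j
        · subst h'; simp [h, Pi.single_apply, Ne.symm h]; ring
        · simp [h, h', Pi.single_apply, Ne.symm h, Ne.symm h']
    simp only [d1, d2, mul_add, Finset.sum_add_distrib, mul_ite, mul_zero]
    simp only [Finset.sum_ite_eq', Finset.mem_univ, if_true, Finset.sum_ite_irrel, Finset.sum_const_zero]
    have c1 : ∀ k, pd j (pd k a) x = pd k (pd j a) x := fun k => by rw [pd_comm ha]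
    simp only [c1]
    ring

/-- exponentials separate symbols -/
lemma symbol_zero (Q : MvPolynomial (Fin n) ℂ)
    (h : ∀ f : (Fin n → ℝ) → ℂ, Sm f → pdl f 0 Q = 0) : Q = 0 := by
  apply MvPolynomial.funext
  intro ξ
  rw [map_zero]
  have hl : Sm (fun y : Fin n → ℝ => ∑ j, (y j : ℂ) * ξ j) := by
    apply ContDiff.sum
    intro j _
    exact ContDiff.mul (Sm.ofReal (contDiff_apply ℝ ℝ j)) contDiff_const
  have hs : Sm (fun y : Fin n → ℝ => Complex.exp (∑ j, (y j : ℂ) * ξ j)) := ContDiff.cexp hl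
  have hd : ∀ j, pd j (fun y : Fin n → ℝ => Complex.exp (∑ j, (y j : ℂ) * ξ j))
      = fun y => ξ j * Complex.exp (∑ j, (y j : ℂ) * ξ j) := by
    intro j
    have h1 : pd j (fun y : Fin n → ℝ => ∑ j, (y j : ℂ) * ξ j) = fun _ => ξ j := by
      rw [pd_sum _ (fun i => ContDiff.mul (Sm.ofReal (contDiff_apply ℝ ℝ i)) contDiff_const)]
      funext y
      rw [Finset.sum_eq_single j]
      · rw [pd_mul (Sm.ofReal (contDiff_apply ℝ ℝ j)) contDiff_const,
          pd_ofReal (contDiff_apply ℝ ℝ j), pd_coord, pd_const]; simp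
      · intro b _ hb
        rw [pd_mul (Sm.ofReal (contDiff_apply ℝ ℝ b)) contDiff_const,
          pd_ofReal (contDiff_apply ℝ ℝ b), pd_coord, pd_const]; simp [hb]
      · simp
    funext y
    have h1' := congrFun h1 y
    unfold pd at h1' ⊢
    rw [((hl.diff y).hasFDerivAt.cexp).fderiv]
    simp only [smul_apply, h1', smul_eq_mul]; ring
  have key : ∀ (P : MvPolynomial (Fin n) ℂ) (x : Fin n → ℝ),
      pdl (fun y : Fin n → ℝ => Complex.exp (∑ j, (y j : ℂ) * ξ j)) x P
        = MvPolynomial.eval ξ P * Complex.exp (∑ j, (x j : ℂ) * ξ j) := by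
    intro P
    induction P using MvPolynomial.induction_on with
    | C c => intro x; simp [pdl_C]
    | add P Q hP hQ => intro x; simp only [map_add, hP, hQ]; ring
    | mul_X P j hP =>
      intro x
      rw [mul_comm, ← pd_pdl P hs]
      simp only [hP]
      rw [pd_cmul _ hs, hd]
      simp; ring
  have := h _ hs
  rw [key] at this
  simpa using this

end basic

section liouville
variable {n : ℕ}

lemma exists_third (hn : 3 ≤ n) (i j : Fin n) : ∃ k : Fin n, k ≠ i ∧ k ≠ j := by
  classical
  have : ({i, j} : Finset (Fin n)).card < (Finset.univ : Finset (Fin n)).card := by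
    have := Finset.card_le_two (a := i) (b := j)
    simp; omega
  obtain ⟨k, _, hk⟩ := Finset.exists_mem_notMem_of_card_lt_card this
  refine ⟨k, ?_⟩
  simpa using hk

/-- metric coefficients -/
def gm (ε : Fin n → ℝ) (i j : Fin n) : ℝ := ε i * (if i = j then 1 else 0)

lemma gm_symm (ε : Fin n → ℝ) (i j : Fin n) : gm ε i j = gm ε j i := by
  unfold gm
  by_cases h : i = j
  · subst h; rfl
  · simp [h, Ne.symm h]

variable {ε : Fin n → ℝ} {Z : (Fin n → ℝ) → (Fin n → ℝ)} {ρ : (Fin n → ℝ) → ℝ}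

lemma kill_smooth (h : IsConformalKillingPair ε Set.univ Z ρ) (i : Fin n) :
    Sm (fun y => Z y i) := by
  have := contDiffOn_univ.1 h.1
  exact contDiff_pi.1 this i

lemma kill_smooth_rho (h : IsConformalKillingPair ε Set.univ Z ρ) : Sm ρ :=
  contDiffOn_univ.1 h.2.1

lemma kill_fst (h : IsConformalKillingPair ε Set.univ Z ρ) (i j : Fin n) :
    (fun x => ε i * pd j (fun y => Z y i) x + ε j * pd i (fun y => Z y j) x)
      = fun x => gm ε i j * ρ x := by
  funext x
  rw [h.2.2 i j x (Set.mem_univ x)]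
  unfold gm; ring

lemma kill_snd0 (h : IsConformalKillingPair ε Set.univ Z ρ) (i j k : Fin n) (x : Fin n → ℝ) :
    ε i * pd k (pd j (fun y => Z y i)) x + ε j * pd k (pd i (fun y => Z y j)) x
      = gm ε i j * pd k ρ x := by
  have h1 := congrArg (fun F => pd k F x) (kill_fst h i j)
  have s := kill_smooth h
  try simp only at h1
  rw [pd_add (ContDiff.mul contDiff_const ((s i).pd j)) (ContDiff.mul contDiff_const ((s j).pd i)),
    pd_cmulR _ ((s i).pd j), pd_cmulR _ ((s j).pd i), pd_cmulR _ (kill_smooth_rho h)] at h1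
  exact h1

lemma kill_snd (h : IsConformalKillingPair ε Set.univ Z ρ) (i j k : Fin n) (x : Fin n → ℝ) :
    2 * ε i * pd k (pd j (fun y => Z y i)) x
      = gm ε i j * pd k ρ x + gm ε i k * pd j ρ x - gm ε j k * pd i ρ x := by
  have h1 := kill_snd0 h i j k x
  have h2 := kill_snd0 h i k j x
  have h3 := kill_snd0 h j k i x
  have s := kill_smooth h
  rw [pd_comm (s i) j k] at h2
  rw [pd_comm (s j) i k, pd_comm (s k) i j] at h3
  linarith

lemma kill_trd (h : IsConformalKillingPair ε Set.univ Z ρ) (i j k l : Fin n) (x : Fin n → ℝ) :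
    2 * ε i * pd l (pd k (pd j (fun y => Z y i))) x
      = gm ε i j * pd l (pd k ρ) x + gm ε i k * pd l (pd j ρ) x - gm ε j k * pd l (pd i ρ) x := by
  have s := kill_smooth h
  have r := kill_smooth_rho h
  have h0 : (fun x => 2 * ε i * pd k (pd j (fun y => Z y i)) x)
      = fun x => (gm ε i j * pd k ρ x + gm ε i k * pd j ρ x) + (- gm ε j k) * pd i ρ x := by
    funext x
    rw [kill_snd h]; ring
  have h1 := congrArg (fun F => pd l F x) h0
  try simp only at h1
  have c : ∀ (a : ℝ) (b : Fin n), Sm (fun x => a * pd b ρ x) :=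
    fun a b => ContDiff.mul contDiff_const (r.pd b)
  rw [pd_cmulR _ (((s i).pd j).pd k), pd_add (ContDiff.add (c _ _) (c _ _)) (c _ _),
    pd_add (c _ _) (c _ _), pd_cmulR _ (r.pd _), pd_cmulR _ (r.pd _), pd_cmulR _ (r.pd _)] at h1
  try simp only at h1
  linarith

lemma kill_rho2 (hn : 3 ≤ n) (hε : ∀ j, ε j = 1 ∨ ε j = -1)
    (h : IsConformalKillingPair ε Set.univ Z ρ) (a b : Fin n) (x : Fin n → ℝ) :
    pd a (pd b ρ) x = 0 := by
  have s := kill_smooth h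
  have r := kill_smooth_rho h
  have sq : ∀ j, ε j * ε j = 1 := fun j => by rcases hε j with h | h <;> simp [h]
  have ne : ∀ j, ε j ≠ 0 := fun j => by rcases hε j with h | h <;> simp [h]
  have key : ∀ i j k l : Fin n, gm ε i k * pd l (pd j ρ) x - gm ε j k * pd l (pd i ρ) x
      = gm ε i l * pd k (pd j ρ) x - gm ε j l * pd k (pd i ρ) x := by
    intro i j k l
    have h1 := kill_trd h i j k l x
    have h2 := kill_trd h i j l k x
    rw [pd_comm ((s i).pd j) k l] at h2
    rw [pd_comm r k l] at h2
    linarith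
  have diag : ∀ i j : Fin n, i ≠ j → ε i * pd j (pd j ρ) x = - (ε j * pd i (pd i ρ) x) := by
    intro i j hij
    have := key i j i j
    simp [gm, hij, Ne.symm hij] at this
    linarith
  by_cases hab : a = b
  · subst hab
    obtain ⟨i, hi, _⟩ := exists_third hn a a
    obtain ⟨j, hj, hji⟩ := exists_third hn a i
    have h1 := diag i a hi
    have h2 := diag j a hj
    have h3 := diag i j hji.symm
    -- multiply
    have e1 : pd a (pd a ρ) x = - (ε a * (ε i * pd i (pd i ρ) x)) := by
      have := congrArg (fun t => ε i * t) h1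
      try simp only at this
      rw [← mul_assoc, sq] at this; linarith
    have e2 : pd a (pd a ρ) x = - (ε a * (ε j * pd j (pd j ρ) x)) := by
      have := congrArg (fun t => ε j * t) h2
      try simp only at this
      rw [← mul_assoc, sq] at this; linarith
    have e3 : ε j * pd j (pd j ρ) x = - (ε i * pd i (pd i ρ) x) := by
      have := congrArg (fun t => ε i * ε j * t) h3
      try simp only at this
      have p : ε i * ε j * (ε i * pd j (pd j ρ) x) = (ε i * ε i) * (ε j * pd j (pd j ρ) x) := by ring
      have q : ε i * ε j * -(ε j * pd i (pd i ρ) x) = -((ε j * ε j) * (ε i * pd i (pd i ρ) x)) := by ring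
      rw [p, q, sq, sq] at this; linarith
    rw [e3] at e2
    linarith
  · obtain ⟨i, hia, hib⟩ := exists_third hn a b
    have := key i b i a
    simp [gm, hia, hib, Ne.symm hia, Ne.symm hib, Ne.symm hab] at this
    exact this.resolve_left (ne i)

lemma kill_third (hn : 3 ≤ n) (hε : ∀ j, ε j = 1 ∨ ε j = -1)
    (h : IsConformalKillingPair ε Set.univ Z ρ) (i j k l : Fin n) (x : Fin n → ℝ) :
    pd l (pd k (pd j (fun y => Z y i))) x = 0 := by
  have ne : ε i ≠ 0 := by rcases hε i with h | h <;> simp [h]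
  have h1 := kill_trd h i j k l x
  simp only [kill_rho2 hn hε h] at h1
  simpa [ne] using h1

lemma kill_second (hε : ∀ j, ε j = 1 ∨ ε j = -1)
    (h : IsConformalKillingPair ε Set.univ Z ρ) (i j k : Fin n) (x : Fin n → ℝ) :
    pd k (pd j (fun y => Z y i)) x
      = 1 / 2 * ((if i = j then pd k ρ x else 0) + (if i = k then pd j ρ x else 0)
        - (if j = k then ε i * ε k * pd i ρ x else 0)) := by
  have sq : ε i * ε i = 1 := by rcases hε i with h | h <;> simp [h]
  have h1 := congrArg (fun t => ε i * t) (kill_snd h i j k x)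
  try simp only at h1
  have e : ε i * (2 * ε i * pd k (pd j (fun y => Z y i)) x)
    = 2 * (ε i * ε i) * pd k (pd j (fun y => Z y i)) x := by ring
  rw [e, sq] at h1
  have e2 : ε i * (gm ε i j * pd k ρ x + gm ε i k * pd j ρ x - gm ε j k * pd i ρ x)
    = (ε i * ε i) * (if i = j then 1 else 0) * pd k ρ x
     + (ε i * ε i) * (if i = k then 1 else 0) * pd j ρ x
      - ε i * ε j * (if j = k then 1 else 0) * pd i ρ x := by unfold gm; ring
  rw [e2, sq] at h1
  have : pd k (pd j (fun y => Z y i)) x = 1 / 2 * (2 * 1 * pd k (pd j (fun y => Z y i)) x) := by ring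
  rw [this, h1]
  congr 1
  by_cases h1 : i = j <;> by_cases h2 : i = k <;> by_cases h3 : j = k <;> simp [h1, h2, h3]

lemma kill_rho_tangent (hn : 3 ≤ n) (hε : ∀ j, ε j = 1 ∨ ε j = -1)
    (h : IsConformalKillingPair ε Set.univ Z ρ) {i₀ : Fin n}
    (ht : ∀ x : Fin n → ℝ, x i₀ = 0 → Z x i₀ = 0) (x : Fin n → ℝ) (hx : x i₀ = 0) :
    pd i₀ ρ x = 0 := by
  obtain ⟨k, hk, _⟩ := exists_third hn i₀ i₀
  have ne : ε k ≠ 0 := by rcases hε k with h | h <;> simp [h]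
  have s := kill_smooth h i₀
  have h0 := pd_tangent (s.pd k) hk (pd_tangent s hk ht) x hx
  have h1 := kill_snd h i₀ k k x
  rw [h0] at h1
  simp [gm, Ne.symm hk, ne] at h1
  exact h1

end liouville

section symbol
open MvPolynomial
variable {n : ℕ}

lemma pderiv_swap (j k : Fin n) (P : MvPolynomial (Fin n) ℂ) :
    pderiv j (pderiv k P) = pderiv k (pderiv j P) := by
  have h : ⁅(pderiv j : Derivation ℂ (MvPolynomial (Fin n) ℂ) (MvPolynomial (Fin n) ℂ)),
      (pderiv k : Derivation ℂ (MvPolynomial (Fin n) ℂ) (MvPolynomial (Fin n) ℂ))⁆ = 0 := by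
    apply MvPolynomial.derivation_ext
    intro i
    rw [Derivation.commutator_apply]
    by_cases h1 : i = j <;> by_cases h2 : i = k <;> simp [Pi.single_apply, h1, h2, pderiv_X] <;>
      split_ifs <;> simp
  have := congrArg (fun D => D P) h
  simp only [Derivation.commutator_apply, Derivation.zero_apply] at this
  exact sub_eq_zero.1 this

/-- symbol of the special conformal condition -/
def specOp (ε : Fin n → ℝ) (u : ℂ) (m : Fin n) (P : MvPolynomial (Fin n) ℂ) :
    MvPolynomial (Fin n) ℂ :=
  ∑ j, X j * pderiv j (pderiv m P)
    - C (1 / 2 * (ε m : ℂ)) * ∑ k, C (ε k : ℂ) * (X m * pderiv k (pderiv k P))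
    + C u * pderiv m P

/-- total defect symbol -/
def defSym (ε : Fin n → ℝ) (u v : ℂ) (A : Fin n → Fin n → ℂ) (r0 : ℂ) (r : Fin n → ℂ)
    (P : MvPolynomial (Fin n) ℂ) : MvPolynomial (Fin n) ℂ :=
  ∑ j, ∑ k, C (A j k) * (X j * pderiv k P) + C ((u - v) / 2 * r0) * P
    + C (1 / 2) * ∑ m, C (r m) * specOp ε u m P

lemma sum_aux (e r : Fin n → ℂ) (T : Fin n → Fin n → Fin n → ℂ) (hT : ∀ j k l, T j k l = T j l k) :
    ∑ j, ∑ k, ∑ l, (1 / 2 * ((if j = k then r l else 0) + (if j = l then r k else 0)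
        - (if k = l then e j * e l * r j else 0))) * T j l k
      = ∑ m, r m * ∑ j, T j j m - 1 / 2 * ∑ m, r m * (e m * ∑ k, e k * T m k k) := by
  have h1 : ∑ j, ∑ k, ∑ l, (if j = k then r l else 0) * T j l k = ∑ m, r m * ∑ j, T j j m := by
    have : ∀ j, ∑ k, ∑ l, (if j = k then r l else 0) * T j l k = ∑ l, r l * T j j l := by
      intro j
      rw [Finset.sum_eq_single j]
      · simp [hT j j]
      · intro b _ hb; simp [Ne.symm hb]
      · simp
    simp only [this, Finset.mul_sum]
    rw [Finset.sum_comm]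
  have h2 : ∑ j, ∑ k, ∑ l, (if j = l then r k else 0) * T j l k = ∑ m, r m * ∑ j, T j j m := by
    simp only [ite_mul, zero_mul, Finset.sum_ite_eq, Finset.mem_univ, if_true, Finset.mul_sum]
    rw [Finset.sum_comm]
  have h3 : ∑ j, ∑ k, ∑ l, (if k = l then e j * e l * r j else 0) * T j l k
      = ∑ m, r m * (e m * ∑ k, e k * T m k k) := by
    simp only [ite_mul, zero_mul, Finset.sum_ite_eq, Finset.mem_univ, if_true, Finset.mul_sum]
    refine Finset.sum_congr rfl fun j _ => Finset.sum_congr rfl fun k _ => ?_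
    ring
  have : ∀ j k l, (1 / 2 * ((if j = k then r l else 0) + (if j = l then r k else 0)
        - (if k = l then e j * e l * r j else 0))) * T j l k
      = 1 / 2 * ((if j = k then r l else 0) * T j l k) + 1 / 2 * ((if j = l then r k else 0) * T j l k)
        - 1 / 2 * ((if k = l then e j * e l * r j else 0) * T j l k) := by
    intros; ring
  simp only [this, Finset.sum_add_distrib, Finset.sum_sub_distrib, ← Finset.mul_sum]
  rw [h1, h2, h3]; ring

variable {ε : Fin n → ℝ} {Z : (Fin n → ℝ) → (Fin n → ℝ)} {ρ : (Fin n → ℝ) → ℝ}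

lemma defect (hn : 3 ≤ n) (hε : ∀ j, ε j = 1 ∨ ε j = -1)
    (h : IsConformalKillingPair ε Set.univ Z ρ) {i₀ : Fin n}
    (ht : ∀ x : Fin n → ℝ, x i₀ = 0 → Z x i₀ = 0) (x : Fin n → ℝ) (hx : x i₀ = 0)
    (u v : ℂ) (P : MvPolynomial (Fin n) ℂ) (f : (Fin n → ℝ) → ℂ) (hf : Sm f) :
    polyDiff P (fun y => (∑ j, (Z y j : ℂ) * pd j f y) + u / 2 * (ρ y : ℂ) * f y) x
        - ((∑ j ∈ Finset.univ.erase i₀, (Z x j : ℂ) * pd j (polyDiff P f) x)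
          + v / 2 * (ρ x : ℂ) * polyDiff P f x)
      = pdl f x (defSym ε u v (fun j k => ((pd k (fun y => Z y j) x : ℝ) : ℂ)) (ρ x)
          (fun m => ((pd m ρ x : ℝ) : ℂ)) P) := by
  have s := kill_smooth h
  have r := kill_smooth_rho h
  have sc : ∀ j, Sm (fun y => (Z y j : ℂ)) := fun j => (s j).ofReal
  have rc : Sm (fun y => (ρ y : ℂ)) := r.ofReal
  have q1 : ∀ j k, pd k (fun y => (Z y j : ℂ)) = fun y => ((pd k (fun y => Z y j) y : ℝ) : ℂ) :=
    fun j k => pd_ofReal (s j) k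
  have q2 : ∀ j k l, pd l (pd k (fun y => (Z y j : ℂ)))
      = fun y => ((pd l (pd k (fun y => Z y j)) y : ℝ) : ℂ) := by
    intro j k l
    rw [q1, pd_ofReal ((s j).pd k)]
  have q3 : ∀ j k l m, ∀ y, pd m (pd l (pd k (fun y => (Z y j : ℂ)))) y = 0 := by
    intro j k l m y
    rw [q2, pd_ofReal (((s j).pd k).pd l)]; simp [kill_third hn hε h]
  have t1 : ∀ k, pd k (fun y => (ρ y : ℂ)) = fun y => ((pd k ρ y : ℝ) : ℂ) :=
    fun k => pd_ofReal r k
  have t2 : ∀ k l, ∀ y, pd l (pd k (fun y => (ρ y : ℂ))) y = 0 := by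
    intro k l y
    rw [t1, pd_ofReal (r.pd k)]; simp [kill_rho2 hn hε h]
  have t3 : ∀ k l m, ∀ y, pd m (pd l (pd k (fun y => (ρ y : ℂ)))) y = 0 := by
    intro k l m y
    have : pd l (pd k (fun y => (ρ y : ℂ))) = fun _ => 0 := funext (t2 k l)
    rw [this, pd_const]
  have e1 : (fun y => (∑ j, (Z y j : ℂ) * pd j f y) + u / 2 * (ρ y : ℂ) * f y)
      = fun y => (∑ j, (Z y j : ℂ) * pd j f y) + u / 2 * ((ρ y : ℂ) * f y) := by
    funext y; ring
  have sj : ∀ j, Sm (fun y => (Z y j : ℂ) * pd j f y) := fun j => ContDiff.mul (sc j) (hf.pd j)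
  have sr : Sm (fun y => (ρ y : ℂ) * f y) := ContDiff.mul rc hf
  have e2 : ∀ j, (Z x j : ℂ) * pd j (polyDiff P f) x = (Z x j : ℂ) * pdl f x (X j * P) := by
    intro j
    rw [← pd_pdl P hf]; rfl
  rw [← pdl_apply, e1, pdl_add_fun P (ContDiff.sum fun j _ => sj j) (ContDiff.mul contDiff_const sr),
    pdl_sum_fun _ P sj, pdl_cmul_fun P _ sr, leibniz P rc hf t3]
  simp only [leibniz P (sc _) (hf.pd _) (q3 _), e2, pdl_pd _ hf, t2, q2, ← pdl_apply]
  simp only [q1, t1]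
  have e3 : ∑ j ∈ Finset.univ.erase i₀, (Z x j : ℂ) * pdl f x (X j * P)
      = ∑ j, (Z x j : ℂ) * pdl f x (X j * P) := by
    apply Finset.sum_subset (Finset.subset_univ _)
    intro j _ hj
    have : j = i₀ := by simpa using hj
    subst this
    simp [ht x hx]
  rw [e3]
  unfold defSym specOp
  simp only [map_add, map_sub, map_sum, pdl_C_mul]
  have key := sum_aux (fun j => (ε j : ℂ)) (fun m => ((pd m ρ x : ℝ) : ℂ))
    (fun j l k => pdl f x (X j * pderiv l (pderiv k P)))
    (by intro j k l; rw [pderiv_swap])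
  have e4 : ∀ j k l, ((pd l (pd k (fun y => Z y j)) x : ℝ) : ℂ)
      = (1 / 2 * ((if j = k then ((pd l ρ x : ℝ) : ℂ) else 0) + (if j = l then ((pd k ρ x : ℝ) : ℂ) else 0)
        - (if k = l then (ε j : ℂ) * (ε l : ℂ) * ((pd j ρ x : ℝ) : ℂ) else 0))) := by
    intro j k l
    rw [kill_second hε h]
    split_ifs <;> push_cast <;> ring
  simp only [e4, Finset.sum_add_distrib, ← Finset.mul_sum]
  rw [key]
  simp only [mul_add, mul_sub, Finset.sum_add_distrib, Finset.sum_sub_distrib]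
  have e5 : ∑ m, ((pd m ρ x : ℝ) : ℂ) * (1 / 2 * (ε m : ℂ) * ∑ k, (ε k : ℂ) * pdl f x (X m * pderiv k (pderiv k P)))
     = 1 / 2 * ∑ m, ((pd m ρ x : ℝ) : ℂ) * ((ε m : ℂ) * ∑ k, (ε k : ℂ) * pdl f x (X m * pderiv k (pderiv k P))) := by
    rw [Finset.mul_sum]
    refine Finset.sum_congr rfl fun m _ => ?_
    ring
  have e6 : ∑ m, ((pd m ρ x : ℝ) : ℂ) * (u * pdl f x (pderiv m P))
     = u * ∑ m, ((pd m ρ x : ℝ) : ℂ) * pdl f x (pderiv m P) := by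
    rw [Finset.mul_sum]
    refine Finset.sum_congr rfl fun m _ => ?_
    ring
  rw [e5, e6]
  simp only [zero_mul, Finset.sum_const_zero]
  ring

/-- algebraic form of covariance -/
def AlgCov (ε : Fin n → ℝ) (i₀ : Fin n) (u v : ℂ) (P : MvPolynomial (Fin n) ℂ) : Prop :=
  (∑ j, X j * pderiv j P + C (u - v) * P = 0) ∧
  (∀ j k, j ≠ i₀ → k ≠ i₀ →
    C (ε k : ℂ) * (X j * pderiv k P) = C (ε j : ℂ) * (X k * pderiv j P)) ∧
  (∀ m, m ≠ i₀ → specOp ε u m P = 0)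

lemma cov_defSym (hn : 3 ≤ n) (hε : ∀ j, ε j = 1 ∨ ε j = -1) {i₀ : Fin n} {u v : ℂ}
    {P : MvPolynomial (Fin n) ℂ} (hP : IsCovariantSymbol ε i₀ u v P)
    (h : IsConformalKillingPair ε Set.univ Z ρ)
    (ht : ∀ x : Fin n → ℝ, x i₀ = 0 → Z x i₀ = 0) :
    defSym ε u v (fun j k => ((pd k (fun y => Z y j) 0 : ℝ) : ℂ)) (ρ 0)
          (fun m => ((pd m ρ 0 : ℝ) : ℂ)) P = 0 := by
  apply symbol_zero
  intro f hf
  rw [← defect hn hε h ht 0 rfl u v P f hf, hP Z ρ h ht f hf 0 rfl, sub_self]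

lemma sm_coord (i : Fin n) : Sm (fun y : Fin n → ℝ => y i) := contDiff_apply ℝ ℝ i

lemma cov_alg (hn : 3 ≤ n) (hε : ∀ j, ε j = 1 ∨ ε j = -1) {i₀ : Fin n} {u v : ℂ}
    {P : MvPolynomial (Fin n) ℂ} (hP : IsCovariantSymbol ε i₀ u v P) : AlgCov ε i₀ u v P := by
  have sq : ∀ j, ε j * ε j = 1 := fun j => by rcases hε j with h | h <;> simp [h]
  refine ⟨?_, ?_, ?_⟩
  · have hk : IsConformalKillingPair ε Set.univ (fun y => y) (fun _ => 2) := by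
      refine ⟨contDiffOn_id, contDiffOn_const, ?_⟩
      intro i j x _
      simp only [pd_coord]
      by_cases h : i = j
      · subst h; simp; ring
      · simp [h, Ne.symm h]
    have := cov_defSym hn hε hP hk (fun x hx => hx)
    simp only [defSym, pd_coord, pd_const] at this
    rw [← this]
    have a : ((u - v) / 2 * ((2 : ℝ) : ℂ)) = u - v := by push_cast; ring
    rw [a]
    have b : ∀ j, ∑ k, C (((if j = k then 1 else 0 : ℝ)) : ℂ) * (X j * pderiv k P)
        = X j * pderiv j P := by
      intro j
      rw [Finset.sum_eq_single j]
      · simp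
      · intro b _ hb; simp [Ne.symm hb]
      · simp
    simp [b]
  · intro j k hj hk
    have sm : ∀ i, Sm (fun y : Fin n → ℝ => ((if i = j then 1 else 0) * ε k) * y k
          + (-((if i = k then 1 else 0) * ε j)) * y j) :=
      fun i => ContDiff.add (ContDiff.mul contDiff_const (sm_coord k))
        (ContDiff.mul contDiff_const (sm_coord j))
    have hd : ∀ i l, pd l (fun y : Fin n → ℝ => ((if i = j then 1 else 0) * ε k) * y k
          + (-((if i = k then 1 else 0) * ε j)) * y j)
        = fun _ => ((if i = j then 1 else 0) * ε k) * (if k = l then 1 else 0)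
          + (-((if i = k then 1 else 0) * ε j)) * (if j = l then 1 else 0) := by
      intro i l
      rw [pd_add (ContDiff.mul contDiff_const (sm_coord k))
        (ContDiff.mul contDiff_const (sm_coord j)), pd_cmulR _ (sm_coord k),
        pd_cmulR _ (sm_coord j), pd_coord, pd_coord]
    have hkk : IsConformalKillingPair ε Set.univ
        (fun y i => ((if i = j then 1 else 0) * ε k) * y k
          + (-((if i = k then 1 else 0) * ε j)) * y j) (fun _ => 0) := by
      refine ⟨contDiffOn_univ.2 (contDiff_pi.2 sm), contDiffOn_const, ?_⟩
      intro i l x _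
      simp only [hd]
      by_cases h1 : i = j <;> by_cases h2 : i = k <;> by_cases h3 : l = j <;> by_cases h4 : l = k
        <;> simp [h1, h2, h3, h4, eq_comm] <;> grind
    have := cov_defSym hn hε hP hkk (fun x hx => by simp [hj.symm, hk.symm])
    simp only [defSym, hd, pd_const] at this
    rw [← sub_eq_zero, ← this]
    simp only [Complex.ofReal_add, Complex.ofReal_mul, Complex.ofReal_neg, map_add, map_mul,
      map_neg, add_mul, Finset.sum_add_distrib]
    have t1 : ∑ i, ∑ l, C (((if i = j then 1 else 0 : ℝ) : ℝ) : ℂ) * C (ε k : ℂ) *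
        C ((if k = l then 1 else 0 : ℝ) : ℂ) * (X i * pderiv l P)
         = C (ε k : ℂ) * (X j * pderiv k P) := by
      rw [Finset.sum_eq_single j, Finset.sum_eq_single k]
      · simp
      · intro b _ hb; simp [Ne.symm hb]
      · simp
      · intro b _ hb; simp [hb]
      · simp
    have t2 : ∑ i, ∑ l, -(C (((if i = k then 1 else 0 : ℝ) : ℝ) : ℂ) * C (ε j : ℂ)) *
        C ((if j = l then 1 else 0 : ℝ) : ℂ) * (X i * pderiv l P)
         = - (C (ε j : ℂ) * (X k * pderiv j P)) := by
      rw [Finset.sum_eq_single k, Finset.sum_eq_single j]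
      · simp
      · intro b _ hb; simp [Ne.symm hb]
      · simp
      · intro b _ hb; simp [hb]
      · simp
    rw [t1, t2]
    simp
    ring
  · intro m hm
    have sk : ∀ k, Sm (fun y : Fin n → ℝ => ε k * (y k * y k)) :=
      fun k => ContDiff.mul contDiff_const (ContDiff.mul (sm_coord k) (sm_coord k))
    have sS : Sm (fun y : Fin n → ℝ => ∑ k, ε k * (y k * y k)) := ContDiff.sum fun k _ => sk k
    have s1 : ∀ i, Sm (fun y : Fin n → ℝ => y m * y i) :=
      fun i => ContDiff.mul (sm_coord m) (sm_coord i)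
    have s2 : ∀ i, Sm (fun y : Fin n → ℝ =>
        (-((if i = m then 1 else 0) * (1 / 2) * ε m)) * ∑ k, ε k * (y k * y k)) :=
      fun i => ContDiff.mul contDiff_const sS
    have hd : ∀ i l, pd l (fun y : Fin n → ℝ => y m * y i +
        (-((if i = m then 1 else 0) * (1 / 2) * ε m)) * ∑ k, ε k * (y k * y k))
        = fun y => (if m = l then 1 else 0) * y i + y m * (if i = l then 1 else 0)
          - (if i = m then 1 else 0) * ε m * (ε l * y l) := by
      intro i l
      rw [pd_add (s1 i) (s2 i), pd_mulR (sm_coord m) (sm_coord i), pd_cmulR _ sS, pd_sum _ sk,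
        pd_coord, pd_coord]
      funext y
      have : ∀ k, pd l (fun y : Fin n → ℝ => ε k * (y k * y k)) y
          = if k = l then 2 * (ε l * y l) else 0 := by
        intro k
        rw [pd_cmulR _ (ContDiff.mul (sm_coord k) (sm_coord k)),
          pd_mulR (sm_coord k) (sm_coord k), pd_coord]
        by_cases h : k = l
        · subst h; simp; ring
        · simp [h]
      simp only [this, Finset.sum_ite_eq', Finset.mem_univ, if_true]
      ring
    have hkk : IsConformalKillingPair ε Set.univ
        (fun y i => y m * y i +
        (-((if i = m then 1 else 0) * (1 / 2) * ε m)) * ∑ k, ε k * (y k * y k))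
        (fun y => 2 * y m) := by
      refine ⟨contDiffOn_univ.2 (contDiff_pi.2 fun i => ContDiff.add (s1 i) (s2 i)),
        contDiffOn_univ.2 (ContDiff.mul contDiff_const (sm_coord m)), ?_⟩
      intro i l x _
      simp only [hd]
      have hm2 := sq m
      by_cases h1 : i = m <;> by_cases h2 : l = m <;> by_cases h3 : i = l
        <;> simp [h1, h2, h3, eq_comm] <;> grind
    have := cov_defSym hn hε hP hkk (fun x hx => by simp [hm.symm, hx])
    simp only [defSym, hd, pd_cmulR _ (sm_coord m), pd_coord] at this
    rw [← this]
    have b : ∑ x, C (((2 * if m = x then 1 else 0 : ℝ)) : ℂ) * specOp ε u x P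
        = C 2 * specOp ε u m P := by
      rw [Finset.sum_eq_single m]
      · simp
      · intro b _ hb; simp [Ne.symm hb]
      · simp
    rw [b, ← mul_assoc, ← C_mul]
    simp

lemma alg_cov (hn : 3 ≤ n) (hε : ∀ j, ε j = 1 ∨ ε j = -1) {i₀ : Fin n} {u v : ℂ}
    {P : MvPolynomial (Fin n) ℂ} (hP : AlgCov ε i₀ u v P) : IsCovariantSymbol ε i₀ u v P := by
  intro Z ρ h ht f hf x hx
  obtain ⟨ha, hb, hc⟩ := hP
  have sq : ∀ j, ε j * ε j = 1 := fun j => by rcases hε j with h | h <;> simp [h]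
  have ne : ∀ j, ε j ≠ 0 := fun j => by rcases hε j with h | h <;> simp [h]
  rw [← sub_eq_zero, defect hn hε h ht x hx u v P f hf]
  suffices hq : defSym ε u v (fun j k => ((pd k (fun y => Z y j) x : ℝ) : ℂ)) (ρ x)
          (fun m => ((pd m ρ x : ℝ) : ℂ)) P = 0 by rw [hq, map_zero]
  unfold defSym
  have z3 : ∑ m, C ((pd m ρ x : ℝ) : ℂ) * specOp ε u m P = 0 := by
    apply Finset.sum_eq_zero
    intro m _
    by_cases hm : m = i₀
    · subst hm; rw [kill_rho_tangent hn hε h ht x hx]; simp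
    · rw [hc m hm, mul_zero]
  rw [z3]
  have hK : ∀ i j, ε i * pd j (fun y => Z y i) x + ε j * pd i (fun y => Z y j) x
      = gm ε i j * ρ x := fun i j => congrFun (kill_fst h i j) x
  have hdiag : ∀ i, pd i (fun y => Z y i) x = ρ x / 2 := by
    intro i
    have := hK i i
    simp [gm] at this
    have h2 : ε i * (2 * pd i (fun y => Z y i) x) = ε i * ρ x := by linarith
    have := mul_left_cancel₀ (ne i) h2
    linarith
  -- off-diagonal part
  let a : Fin n → Fin n → ℝ := fun j k => pd k (fun y => Z y j) x - (if j = k then ρ x / 2 else 0)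
  have aanti : ∀ j k, ε j * a j k = - (ε k * a k j) := by
    intro j k
    have := hK j k
    simp only [a]
    by_cases hjk : j = k
    · subst hjk; simp [hdiag]
    · simp [gm, hjk] at this
      simp [hjk, Ne.symm hjk]; linarith
  have a0 : ∀ k, a i₀ k = 0 := by
    intro k
    simp only [a]
    by_cases hk : i₀ = k
    · subst hk; simp [hdiag]
    · simp [hk, pd_tangent (kill_smooth h i₀) (Ne.symm hk) ht x hx]
  have a0' : ∀ k, a k i₀ = 0 := by
    intro k
    have := aanti k i₀
    rw [a0] at this
    simpa [ne] using this
  have hflip : ∀ j k, C (a j k : ℂ) * (X j * pderiv k P) = - (C (a k j : ℂ) * (X k * pderiv j P)) := by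
    intro j k
    by_cases hj : j = i₀
    · subst hj; simp [a0, a0']
    by_cases hk : k = i₀
    · subst hk; simp [a0, a0']
    have e1 : (a j k : ℂ) = ((a j k * ε k : ℝ) : ℂ) * (ε k : ℂ) := by
      rw [← Complex.ofReal_mul, mul_assoc, sq, mul_one]
    have e2 : a j k * ε k * ε j = - a k j := by
      have : a j k * ε k * ε j = ε k * (ε j * a j k) := by ring
      rw [this, aanti, mul_neg, ← mul_assoc, sq, one_mul]
    rw [e1, C_mul, mul_assoc, hb j k hj hk, ← mul_assoc, ← C_mul, ← Complex.ofReal_mul, e2]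
    simp
  have hS : ∑ j, ∑ k, C (a j k : ℂ) * (X j * pderiv k P) = 0 := by
    have h1 : ∑ j, ∑ k, C (a j k : ℂ) * (X j * pderiv k P)
        = - ∑ j, ∑ k, C (a j k : ℂ) * (X j * pderiv k P) := by
      conv_lhs => rw [Finset.sum_comm]
      rw [← Finset.sum_neg_distrib]
      refine Finset.sum_congr rfl fun j _ => ?_
      rw [← Finset.sum_neg_distrib]
      exact Finset.sum_congr rfl fun k _ => hflip k j
    exact self_eq_neg.1 h1
  have hA : ∀ j k, C ((pd k (fun y => Z y j) x : ℝ) : ℂ) * (X j * pderiv k P)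
      = C (a j k : ℂ) * (X j * pderiv k P)
        + (if j = k then C ((ρ x : ℂ) / 2) * (X j * pderiv j P) else 0) := by
    intro j k
    simp only [a]
    by_cases hjk : j = k
    · subst hjk
      simp [← add_mul, ← C_add]
    · simp [hjk]
  simp only [hA, Finset.sum_add_distrib, hS, Finset.sum_ite_eq, Finset.mem_univ, if_true,
    ← Finset.mul_sum]
  have e : C ((u - v) / 2 * (ρ x : ℂ)) * P = C ((ρ x : ℂ) / 2) * (C (u - v) * P) := by
    rw [← mul_assoc, ← C_mul]; congr 2; ring
  rw [e, zero_add, ← mul_add, ha]; simp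

/-- complex rescaling of the variables -/
def resc (c : Fin n → ℂ) : MvPolynomial (Fin n) ℂ →ₐ[ℂ] MvPolynomial (Fin n) ℂ :=
  aeval (fun j => C (c j) * X j)

lemma resc_C (c : Fin n → ℂ) (a : ℂ) : resc c (C a) = C a := by
  unfold resc; rw [← algebraMap_eq, AlgHom.commutes]

lemma resc_X (c : Fin n → ℂ) (j : Fin n) : resc c (X j) = C (c j) * X j := by
  simp [resc]

lemma pderiv_resc (c : Fin n → ℂ) (k : Fin n) (P : MvPolynomial (Fin n) ℂ) :
    pderiv k (resc c P) = C (c k) * resc c (pderiv k P) := by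
  induction P using MvPolynomial.induction_on with
  | C a => simp [resc_C]
  | add P Q hP hQ => simp only [map_add, hP, hQ, mul_add]
  | mul_X P j hP =>
    rw [map_mul, Derivation.leibniz, Derivation.leibniz, hP, resc_X, Derivation.leibniz]
    by_cases h : k = j
    · subst h; simp [resc_X]; ring
    · simp [resc_X, Pi.single_apply, Ne.symm h]; ring

lemma resc_inj (c d : Fin n → ℂ) (h : ∀ j, c j * d j = 1) (P : MvPolynomial (Fin n) ℂ) :
    resc d (resc c P) = P := by
  have : (resc d).comp (resc c) = AlgHom.id ℂ _ := by
    apply MvPolynomial.algHom_ext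
    intro j
    simp only [AlgHom.comp_apply, resc_X, map_mul, resc_C, AlgHom.id_apply]
    rw [← mul_assoc, ← C_mul, h]; simp
  exact congrArg (fun F => F P) this

lemma alg_transfer {ε' : Fin n → ℝ} (c : Fin n → ℂ) (hc0 : ∀ j, c j ≠ 0)
    (hc : ∀ j, (ε' j : ℂ) * (c j * c j) = ε j)
    (hc4 : ∀ j, c j ^ 4 = 1)
    {i₀ : Fin n} {u v : ℂ} {P : MvPolynomial (Fin n) ℂ} (hP : AlgCov ε i₀ u v P) :
    AlgCov ε' i₀ u v (resc c P) := by
  obtain ⟨h1, h2, h3⟩ := hP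
  have hX : ∀ j (R : MvPolynomial (Fin n) ℂ), C (c j) * (X j * R) = resc c (X j) * R := by
    intro j R; rw [resc_X, mul_assoc]
  refine ⟨?_, ?_, ?_⟩
  · have := congrArg (resc c) h1
    rw [map_zero] at this
    rw [← this]
    simp only [map_add, map_sum, map_mul, resc_C, pderiv_resc, resc_X]
    congr 1
    refine Finset.sum_congr rfl fun j _ => ?_
    ring
  · intro j k hj hk
    have := congrArg (resc c) (h2 j k hj hk)
    simp only [map_mul, resc_C, resc_X, ← hc] at this
    simp only [pderiv_resc]
    have hne : (C (c j) * C (c k) : MvPolynomial (Fin n) ℂ) ≠ 0 := by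
      rw [← C_mul]; simp [hc0]
    apply mul_left_cancel₀ hne
    linear_combination this
  · intro m hm
    have := congrArg (resc c) (h3 m hm)
    unfold specOp at this ⊢
    rw [map_zero] at this
    rw [← mul_zero (C (c m)), ← this]
    simp only [map_add, map_sub, map_sum, map_mul, resc_C, pderiv_resc, resc_X, ← hc,
      Derivation.leibniz, pderiv_C, smul_eq_mul, mul_zero, add_zero, mul_add, mul_sub,
      Finset.mul_sum]
    refine congrArg₂ _ (congrArg₂ _ ?_ ?_) ?_
    · refine Finset.sum_congr rfl fun j _ => ?_
      ring
    · refine Finset.sum_congr rfl fun j _ => ?_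
      have h4 : (C (c m) ^ 4 : MvPolynomial (Fin n) ℂ) = 1 := by rw [← C_pow, hc4, C_1]
      linear_combination (-(C (1 / 2) * C (ε' m : ℂ) * C (ε' j : ℂ) * X m * C (c j) ^ 2
        * resc c (pderiv j (pderiv j P)))) * h4
    · ring

lemma one_dir (hn : 3 ≤ n) {ε' : Fin n → ℝ}
    (hε : ∀ j, ε j = 1 ∨ ε j = -1) (hε' : ∀ j, ε' j = 1 ∨ ε' j = -1) (i₀ : Fin n) (u v : ℂ)
    (h : ∃ P : MvPolynomial (Fin n) ℂ, P ≠ 0 ∧ IsCovariantSymbol ε i₀ u v P) :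
    ∃ P : MvPolynomial (Fin n) ℂ, P ≠ 0 ∧ IsCovariantSymbol ε' i₀ u v P := by
  obtain ⟨P, hP0, hP⟩ := h
  have hex : ∀ j, ∃ c : ℂ, c ≠ 0 ∧ (ε' j : ℂ) * (c * c) = ε j ∧ c ^ 4 = 1 := by
    intro j
    rcases hε j with h | h <;> rcases hε' j with h' | h' <;> rw [h, h']
    · exact ⟨1, by simp, by simp, by simp⟩
    · exact ⟨Complex.I, by simp, by simp, by simp⟩
    · exact ⟨Complex.I, by simp, by simp, by simp⟩
    · exact ⟨1, by simp, by simp, by simp⟩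
  choose c hc0 hc hc4 using hex
  refine ⟨resc c P, ?_, alg_cov hn hε' (alg_transfer c hc0 hc hc4 (cov_alg hn hε hP))⟩
  intro h0
  apply hP0
  rw [← resc_inj c (fun j => (c j)⁻¹) (fun j => mul_inv_cancel₀ (hc0 j)) P, h0, map_zero]

end symbol

theorem stmt4 (n : ℕ) (hn : 3 ≤ n) (ε ε' : Fin n → ℝ)
    (hε : ∀ j, ε j = 1 ∨ ε j = -1) (hε' : ∀ j, ε' j = 1 ∨ ε' j = -1) (u v : ℂ) :
    (∃ P : MvPolynomial (Fin n) ℂ, P ≠ 0 ∧ IsCovariantSymbol ε ⟨n - 1, by omega⟩ u v P) ↔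
    (∃ P : MvPolynomial (Fin n) ℂ, P ≠ 0 ∧ IsCovariantSymbol ε' ⟨n - 1, by omega⟩ u v P) := by
  exact ⟨one_dir hn hε hε' _ u v, one_dir hn hε' hε _ u v⟩
end
end
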